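/- Let x ∈ M_{m,n}(ℂ) and let w ∈ S_N with w ≥ (w∘ⁿ,w∘ᵐ) in the Bruhat order, and write the permutation matrix of w in block form w = [[w₁₁, w₁₂],[w₂₁, w₂₂]] with w₁₁ ∈ M_n(ℂ), w₁₂ ∈ M_{n,m}(ℂ), w₂₁ ∈ M_{m,n}(ℂ), w₂₂ ∈ M_m(ℂ). Then x ∈ P_w if and only if all four of the following hold: (a) rank(x_{[p,…,m;1,…,q]}) = rank((w₂₁)_{[p,…,m;1,…,q]}) for p = 1,…,m and q = 1,…,n; (b) rank(x_{[1,…,p;q,…,n]}) = rank((w∘ᵐ w₁₂ᵀ w∘ⁿ)_{[1,…,p;q,…,n]}) for p = 1,…,m and q = 1,…,n; (c) rank(x_{[1,…,m;p,…,q]}) = q+1−p − rank((w∘ⁿ w₁₁)_{[p,…,n;p,…,q]}) for all 2 ≤ p ≤ q ≤ n; (d) rank(x_{[p,…,q;1,…,n]}) = q+1−p − rank((w₂₂ w∘ᵐ)_{[p,…,q;1,…,q]}) for all 1 ≤ p ≤ q ≤ m−1. Furthermore, x lies in the Zariski closure of P_w in M_{m,n}(ℂ) if and only if conditions (a)–(d)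 hold with each rank equality replaced by ≤. -/

import Mathlib

open Matrix

noncomputable section

abbrev Mat (k l : ℕ) := Matrix (Fin k) (Fin l) ℂ

/-- permutation matrix: (i,j) entry is 1 exactly when i = w j -/
def permMat (k : ℕ) (w : Equiv.Perm (Fin k)) : Mat k k :=
  fun i j => if i = w j then 1 else 0

/-- invertible upper triangular matrices -/
def Bp (k : ℕ) : Set (Mat k k) := {M | IsUnit M ∧ ∀ i j : Fin k, j < i → M i j = 0}

/-- invertible lower triangular matrices -/
def Bm (k : ℕ) : Set (Mat k k) := {M | IsUnit M ∧ ∀ i j : Fin k, i < j → M i j = 0}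

def dcPlus {k l : ℕ} (w : Mat k l) : Set (Mat k l) :=
  {x | ∃ b ∈ Bp k, ∃ b' ∈ Bp l, x = b * w * b'}

def dcMinus {k l : ℕ} (w : Mat k l) : Set (Mat k l) :=
  {x | ∃ b ∈ Bm k, ∃ b' ∈ Bm l, x = b * w * b'}

/-- comparison of finsets: sorted lists compare termwise -/
def finsetLE {k : ℕ} (A B : Finset (Fin k)) : Prop :=
  List.Forall₂ (· ≤ ·) (A.sort (· ≤ ·)) (B.sort (· ≤ ·))

/-- Bruhat order on S_k -/
def bruhatLE {k : ℕ} (y z : Equiv.Perm (Fin k)) : Prop :=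
  ∀ p : Fin k, finsetLE ((Finset.Iic p).image y) ((Finset.Iic p).image z)

/-- Zariski closure in the space of k×l matrices -/
def zClosure {k l : ℕ} (S : Set (Mat k l)) : Set (Mat k l) :=
  {x | ∀ p : MvPolynomial (Fin k × Fin l) ℂ,
      (∀ y ∈ S, MvPolynomial.eval (fun q => y q.1 q.2) p = 0) →
      MvPolynomial.eval (fun q => x q.1 q.2) p = 0}

def revP (k : ℕ) : Equiv.Perm (Fin k) := ⟨Fin.rev, Fin.rev, Fin.rev_rev, Fin.rev_rev⟩

def fe (m n : ℕ) : Fin n ⊕ Fin m ≃ Fin (m + n) :=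
  finSumFinEquiv.trans (finCongr (Nat.add_comm n m))

/-- the block matrix [[w∘ⁿ, 0],[x, w∘ᵐ]] -/
def embMat (m n : ℕ) (x : Mat m n) : Mat (m+n) (m+n) :=
  Matrix.reindex (fe m n) (fe m n)
    (Matrix.fromBlocks (permMat n (revP n)) 0 x (permMat m (revP m)))

/-- the permutation (w∘ⁿ,w∘ᵐ) ∈ S_{m+n} -/
def wnmPerm (m n : ℕ) : Equiv.Perm (Fin (m+n)) :=
  ((fe m n).symm.trans (Equiv.sumCongr (revP n) (revP m))).trans (fe m n)

def Pset (m n : ℕ) (w : Equiv.Perm (Fin (m+n))) : Set (Mat m n) :=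
  {x | embMat m n x ∈ dcPlus (permMat (m+n) w)}

/-- the matrix with t×t identity in upper-left corner, zeros elsewhere -/
def Imn (m n t : ℕ) : Mat m n := fun i j => if (i:ℕ) = (j:ℕ) ∧ (i:ℕ) < t then 1 else 0

/-- diagonal matrix with first t diagonal entries 0 and the rest 1 -/
def Jk (k t : ℕ) : Mat k k := fun i j => if (i:ℕ) = (j:ℕ) ∧ t ≤ (i:ℕ) then 1 else 0

noncomputable def subRank {k l : ℕ} (x : Mat k l) (R : Finset (Fin k)) (C : Finset (Fin l)) : ℕ :=
  (x.submatrix (fun i : {a // a ∈ R} => i.1) (fun j : {a // a ∈ C} => j.1)).rank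

/-- v(1) < ⋯ < v(t) -/
def headMono {k : ℕ} (t : ℕ) (v : Equiv.Perm (Fin k)) : Prop :=
  ∀ i j : Fin k, i < j → (j:ℕ) < t → v i < v j

/-- u(t+1) < ⋯ < u(k) -/
def tailMono {k : ℕ} (t : ℕ) (u : Equiv.Perm (Fin k)) : Prop :=
  ∀ i j : Fin k, i < j → t ≤ (i:ℕ) → u i < u j

def embPerm {k t : ℕ} (h : t ≤ k) (τ : Equiv.Perm (Fin t)) : Equiv.Perm (Fin k) :=
  τ.viaFintypeEmbedding (Fin.castLEEmb h)
def castTop {m n : ℕ} (i : Fin n) : Fin (m+n) := Fin.castLE (Nat.le_add_left n m) i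

def castBot {m n : ℕ} (i : Fin m) : Fin (m+n) := ⟨n + (i:ℕ), by have := i.isLt; omega⟩

/-- upper-left n×n block -/
def blk11 (m n : ℕ) (g : Mat (m+n) (m+n)) : Mat n n := g.submatrix castTop castTop
/-- upper-right n×m block -/
def blk12 (m n : ℕ) (g : Mat (m+n) (m+n)) : Mat n m := g.submatrix castTop castBot
/-- lower-left m×n block -/
def blk21 (m n : ℕ) (g : Mat (m+n) (m+n)) : Mat m n := g.submatrix castBot castTop
/-- lower-right m×m block -/
def blk22 (m n : ℕ) (g : Mat (m+n) (m+n)) : Mat m m := g.submatrix castBot castBot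


/-! ### Rank lemmas -/

lemma subRank_image {k l k' l' : ℕ} (M : Mat k l) (f : Fin k' → Fin k) (g : Fin l' → Fin l)
    (hf : Function.Injective f) (hg : Function.Injective g)
    (R : Finset (Fin k')) (C : Finset (Fin l')) :
    subRank (M.submatrix f g) R C = subRank M (R.image f) (C.image g) := by
  classical
  unfold subRank
  let ef : {a // a ∈ R} ≃ {a // a ∈ R.image f} :=
    Equiv.ofBijective (fun a => ⟨f a.1, Finset.mem_image_of_mem f a.2⟩) (by
      constructor
      · intro a b h
        exact Subtype.ext (hf (congrArg Subtype.val h))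
      · rintro ⟨b, hb⟩
        obtain ⟨a, ha, rfl⟩ := Finset.mem_image.1 hb
        exact ⟨⟨a, ha⟩, rfl⟩)
  let eg : {a // a ∈ C} ≃ {a // a ∈ C.image g} :=
    Equiv.ofBijective (fun a => ⟨g a.1, Finset.mem_image_of_mem g a.2⟩) (by
      constructor
      · intro a b h
        exact Subtype.ext (hg (congrArg Subtype.val h))
      · rintro ⟨b, hb⟩
        obtain ⟨a, ha, rfl⟩ := Finset.mem_image.1 hb
        exact ⟨⟨a, ha⟩, rfl⟩)
  rw [← Matrix.rank_submatrix (M.submatrix (fun i : {a // a ∈ R.image f} => i.1)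
    (fun j : {a // a ∈ C.image g} => j.1)) ef eg]
  rfl

lemma subRank_transpose {k l : ℕ} (M : Mat k l) (R : Finset (Fin k)) (C : Finset (Fin l)) :
    subRank M.transpose C R = subRank M R C := by
  unfold subRank
  rw [← Matrix.rank_transpose]
  rfl

lemma rank_add_ker {R C : Type*} [Fintype R] [Fintype C] (M : Matrix R C ℂ) :
    M.rank + Module.finrank ℂ (LinearMap.ker M.mulVecLin) = Fintype.card C := by
  have := LinearMap.finrank_range_add_finrank_ker M.mulVecLin
  rw [Module.finrank_fintype_fun_eq_card] at this
  exact this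

lemma subRank_pivot {k l : ℕ} (M : Mat k l) (R R' : Finset (Fin k)) (C C' : Finset (Fin l))
    (hR : R' ⊆ R) (hC : C' ⊆ C)
    (h1 : ∀ c ∈ C, c ∉ C' → ∃ r ∈ R, ∀ c' ∈ C, M r c' = if c' = c then 1 else 0)
    (h2 : ∀ r ∈ R, r ∉ R' → ∀ c ∈ C', M r c = 0) :
    subRank M R C + C'.card = subRank M R' C' + C.card := by
  classical
  unfold subRank
  set A := M.submatrix (fun i : {a // a ∈ R} => i.1) (fun j : {a // a ∈ C} => j.1) with hA
  set D := M.submatrix (fun i : {a // a ∈ R'} => i.1) (fun j : {a // a ∈ C'} => j.1) with hD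
  have e1 := rank_add_ker A
  have e2 := rank_add_ker D
  have key : ∀ v : {a // a ∈ C} → ℂ, (∀ c : {a // a ∈ C}, c.1 ∉ C' → v c = 0) →
      ∀ r : {a // a ∈ R}, (A *ᵥ v) r = ∑ c : {a // a ∈ C'}, M r.1 c.1 * v ⟨c.1, hC c.2⟩ := by
    intro v hv r
    simp only [Matrix.mulVec, dotProduct, hA, Matrix.submatrix_apply]
    symm
    refine Finset.sum_of_injOn (fun c : {a // a ∈ C'} => (⟨c.1, hC c.2⟩ : {a // a ∈ C})) ?_ ?_ ?_ ?_
    · intro a _ b _ h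
      exact Subtype.ext (by simpa using h)
    · intro a _; simp
    · intro a _ ha
      rw [hv a, mul_zero]
      intro hc
      exact ha ⟨⟨a.1, hc⟩, by simp⟩
    · intro a _; rfl
  have kv : ∀ v : {a // a ∈ C} → ℂ, A *ᵥ v = 0 → ∀ c : {a // a ∈ C}, c.1 ∉ C' → v c = 0 := by
    intro v hv c hc
    obtain ⟨r, hr, h⟩ := h1 c.1 c.2 hc
    have := congrFun hv ⟨r, hr⟩
    simp only [Matrix.mulVec, dotProduct, hA, Matrix.submatrix_apply, Pi.zero_apply] at this
    rw [Finset.sum_eq_single c] at this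
    · rw [h c.1 c.2, if_pos rfl, one_mul] at this; exact this
    · intro b _ hb
      rw [h b.1 b.2, if_neg, zero_mul]
      intro e; exact hb (Subtype.ext e)
    · simp
  let φ : LinearMap.ker A.mulVecLin →ₗ[ℂ] LinearMap.ker D.mulVecLin :=
    { toFun := fun v => ⟨fun c => v.1 ⟨c.1, hC c.2⟩, by
        have hv : A *ᵥ v.1 = 0 := LinearMap.mem_ker.1 v.2
        rw [LinearMap.mem_ker, Matrix.mulVecLin_apply]
        funext r
        have := key v.1 (kv _ hv) ⟨r.1, hR r.2⟩
        rw [hv] at this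
        simp only [Matrix.mulVec, dotProduct, hD, Matrix.submatrix_apply]
        exact this.symm⟩
      map_add' := fun _ _ => rfl
      map_smul' := fun _ _ => rfl }
  have hφ : Function.Bijective φ := by
    constructor
    · rintro ⟨v, hv⟩ ⟨u, hu⟩ h
      have hv : A *ᵥ v = 0 := by simpa using hv
      have hu : A *ᵥ u = 0 := by simpa using hu
      apply Subtype.ext
      funext c
      by_cases hc : c.1 ∈ C'
      · exact congrFun (congrArg Subtype.val h) ⟨c.1, hc⟩
      · show v c = u c
        rw [kv v hv c hc, kv u hu c hc]
    · rintro ⟨u, hu⟩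
      have hu : D *ᵥ u = 0 := by simpa using hu
      let v : {a // a ∈ C} → ℂ := fun c => if h : c.1 ∈ C' then u ⟨c.1, h⟩ else 0
      have hv0 : ∀ c : {a // a ∈ C}, c.1 ∉ C' → v c = 0 := by
        intro c hc; simp [v, hc]
      have hv1 : ∀ c : {a // a ∈ C'}, v ⟨c.1, hC c.2⟩ = u c := by
        intro c; simp [v]
      have hv : A *ᵥ v = 0 := by
        funext r
        rw [key v hv0 r]
        by_cases hr : r.1 ∈ R'
        · have := congrFun hu ⟨r.1, hr⟩
          simp only [Matrix.mulVec, dotProduct, hD, Matrix.submatrix_apply] at this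
          refine Eq.trans ?_ this
          exact Finset.sum_congr rfl (fun c _ => by rw [hv1])
        · apply Finset.sum_eq_zero
          intro c _
          rw [h2 r.1 r.2 hr c.1 c.2, zero_mul]
      refine ⟨⟨v, by simpa using hv⟩, ?_⟩
      apply Subtype.ext
      funext c
      exact hv1 c
  have e3 := (LinearEquiv.ofBijective φ hφ).finrank_eq
  rw [Fintype.card_coe] at e1 e2
  omega

lemma subRank_le_left {k l k' : ℕ} (b : Mat k' k) (M : Mat k l) (R : Finset (Fin k'))
    (R' : Finset (Fin k)) (C : Finset (Fin l))
    (h : ∀ r ∈ R, ∀ s, s ∉ R' → b r s = 0) : subRank (b * M) R C ≤ subRank M R' C := by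
  classical
  have : (b * M).submatrix (fun i : {a // a ∈ R} => i.1) (fun j : {a // a ∈ C} => j.1) =
      b.submatrix (fun i : {a // a ∈ R} => i.1) (fun i : {a // a ∈ R'} => i.1) *
      M.submatrix (fun i : {a // a ∈ R'} => i.1) (fun j : {a // a ∈ C} => j.1) := by
    ext r c
    simp only [Matrix.mul_apply, Matrix.submatrix_apply]
    symm
    rw [Finset.sum_coe_sort R' (fun s => b r.1 s * M s c.1)]
    apply Finset.sum_subset (Finset.subset_univ _)
    intro s _ hs
    rw [h r.1 r.2 s hs, zero_mul]
  unfold subRank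
  rw [this]
  exact Matrix.rank_mul_le_right _ _

lemma subRank_le_right {k l l' : ℕ} (b : Mat l l') (M : Mat k l) (R : Finset (Fin k))
    (C : Finset (Fin l')) (C' : Finset (Fin l))
    (h : ∀ c ∈ C, ∀ s, s ∉ C' → b s c = 0) : subRank (M * b) R C ≤ subRank M R C' := by
  rw [← subRank_transpose, ← subRank_transpose M, Matrix.transpose_mul]
  exact subRank_le_left _ _ _ _ _ h

/-- rank of a 0/1 partial permutation matrix -/
lemma subRank_perm {k l : ℕ} {K : Type*} [DecidableEq K] (M : Mat k l) (e : Fin k → K)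
    (f : Fin l → K)
    (hf : Function.Injective f)
    (hM : ∀ r c, M r c = if e r = f c then 1 else 0)
    (R : Finset (Fin k)) (C : Finset (Fin l)) :
    subRank M R C = (C.filter (fun c => ∃ r ∈ R, e r = f c)).card := by
  classical
  have := subRank_pivot M R ∅ C (C.filter (fun c => ¬ ∃ r ∈ R, e r = f c)) (by simp)
    (Finset.filter_subset _ _) (by
      intro c hc hc'
      simp only [Finset.mem_filter, hc, true_and, not_not] at hc'
      obtain ⟨r, hr, h⟩ := hc'
      refine ⟨r, hr, fun c' _ => ?_⟩
      rw [hM, h]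
      simp only [hf.eq_iff, eq_comm]) (by
      intro r hr _ c hc
      rw [hM, if_neg]
      intro h
      exact (Finset.mem_filter.1 hc).2 ⟨r, hr, h⟩)
  have h0 : subRank M ∅ (C.filter (fun c => ¬ ∃ r ∈ R, e r = f c)) = 0 := by
    unfold subRank
    have := Matrix.rank_le_card_height (M.submatrix (fun i : {a // a ∈ (∅ : Finset (Fin k))} => i.1)
      (fun j : {a // a ∈ (C.filter (fun c => ¬ ∃ r ∈ R, e r = f c))} => j.1))
    simpa using this
  have h3 := Finset.card_filter_add_card_filter_not (s := C) (fun c => ∃ r ∈ R, e r = f c)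
  omega

/-! ### The group of upper triangular matrices -/

lemma Bp_one (k : ℕ) : (1 : Mat k k) ∈ Bp k :=
  ⟨isUnit_one, fun _ _ h => Matrix.one_apply_ne (ne_of_gt h)⟩

lemma Bp_mul {k : ℕ} {a b : Mat k k} (ha : a ∈ Bp k) (hb : b ∈ Bp k) : a * b ∈ Bp k := by
  refine ⟨ha.1.mul hb.1, fun i j h => ?_⟩
  rw [Matrix.mul_apply]
  apply Finset.sum_eq_zero
  intro s _
  rcases lt_or_ge s i with hs | hs
  · rw [ha.2 i s hs, zero_mul]
  · rw [hb.2 s j (lt_of_lt_of_le h hs), mul_zero]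

lemma Bp_inv {k : ℕ} {a : Mat k k} (ha : a ∈ Bp k) : ∃ b ∈ Bp k, a * b = 1 ∧ b * a = 1 := by
  have hu : IsUnit a.det := (Matrix.isUnit_iff_isUnit_det a).1 ha.1
  let _ : Invertible a := Matrix.invertibleOfIsUnitDet a hu
  refine ⟨a⁻¹, ⟨?_, ?_⟩, Matrix.mul_nonsing_inv a hu, Matrix.nonsing_inv_mul a hu⟩
  · exact (Matrix.isUnit_iff_isUnit_det _).2 (Matrix.isUnit_nonsing_inv_det a hu)
  · have : a.BlockTriangular id := fun i j h => ha.2 i j h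
    have h2 := Matrix.blockTriangular_inv_of_blockTriangular this
    intro i j h
    exact h2 h

lemma Bp_of_diag {k : ℕ} {a : Mat k k} (h : ∀ i j : Fin k, j < i → a i j = 0)
    (hd : ∀ i, a i i ≠ 0) : a ∈ Bp k := by
  refine ⟨?_, h⟩
  rw [Matrix.isUnit_iff_isUnit_det]
  have : a.BlockTriangular id := fun i j h' => h i j h'
  rw [Matrix.det_of_isUpperTriangular this]
  exact (Finset.prod_ne_zero_iff.2 fun i _ => hd i).isUnit

lemma dcPlus_mem_of {k : ℕ} {w g : Mat k k} {b b' : Mat k k} (hb : b ∈ Bp k) (hb' : b' ∈ Bp k)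
    (h : b * g * b' ∈ dcPlus w) : g ∈ dcPlus w := by
  obtain ⟨c, hc, c', hc', e⟩ := h
  obtain ⟨d, hd, -, hd1⟩ := Bp_inv hb
  obtain ⟨d', hd', hd1', -⟩ := Bp_inv hb'
  refine ⟨d * c, Bp_mul hd hc, c' * d', Bp_mul hc' hd', ?_⟩
  calc g = (d * b) * g * (b' * d') := by rw [hd1, hd1']; simp
    _ = d * (b * g * b') * d' := by simp only [Matrix.mul_assoc]
    _ = _ := by rw [e]; simp only [Matrix.mul_assoc]

/-- Corner rank: rows `≥ i`, columns `< j` (zero-indexed). -/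
def cr {k l : ℕ} (g : Mat k l) (i j : ℕ) : ℕ :=
  subRank g (Finset.univ.filter (fun a => i ≤ a.1)) (Finset.univ.filter (fun b => b.1 < j))

lemma cr_mul_le {k : ℕ} {g b b' : Mat k k} (hb : b ∈ Bp k) (hb' : b' ∈ Bp k) (i j : ℕ) :
    cr (b * g * b') i j ≤ cr g i j := by
  refine le_trans (subRank_le_right b' (b * g) _ _ (Finset.univ.filter (fun b => b.1 < j)) ?_)
    (subRank_le_left b g _ (Finset.univ.filter (fun a => i ≤ a.1)) _ ?_)
  · intro c hc s hs
    simp only [Finset.mem_filter, Finset.mem_univ, true_and] at hc hs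
    exact hb'.2 _ _ (Fin.lt_def.2 (by omega))
  · intro r hr s hs
    simp only [Finset.mem_filter, Finset.mem_univ, true_and] at hr hs
    exact hb.2 _ _ (Fin.lt_def.2 (by omega))

lemma cr_of_mem {k : ℕ} {w g : Mat k k} (h : g ∈ dcPlus w) (i j : ℕ) : cr g i j = cr w i j := by
  obtain ⟨c, hc, c', hc', e⟩ := h
  apply le_antisymm
  · rw [e]; exact cr_mul_le hc hc' i j
  · obtain ⟨d, hd, -, hd1⟩ := Bp_inv hc
    obtain ⟨d', hd', hd1', -⟩ := Bp_inv hc'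
    have : w = d * g * d' := by
      calc w = (d * c) * w * (c' * d') := by rw [hd1, hd1']; simp
        _ = _ := by rw [e]; simp only [Matrix.mul_assoc]
    conv_lhs => rw [this]
    exact cr_mul_le hd hd' i j

/-! ### Bruhat decomposition -/

lemma bruhat_step {k : ℕ} (g : Mat k k) (hg : IsUnit g) (t : ℕ) (ht : t ≤ k) :
    ∃ b ∈ Bp k, ∃ b' ∈ Bp k, ∃ u : Fin k → Fin k, ∀ j : Fin k, j.1 < t → ∀ i,
      (b * g * b') i j = if i = u j then 1 else 0 := by
  induction t with
  | zero => exact ⟨1, Bp_one k, 1, Bp_one k, id, fun j hj => absurd hj (by omega)⟩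
  | succ t ih =>
    obtain ⟨b, hb, b', hb', u, hu⟩ := ih (by omega)
    set h := b * g * b' with hh
    let κ : Fin k := ⟨t, by omega⟩
    let d : Mat k k := fun a c => if a = c then 1 else if c = κ ∧ a < κ then - h (u a) κ else 0
    have hd : d ∈ Bp k := by
      apply Bp_of_diag
      · intro i j hij
        simp only [d]
        rw [if_neg (ne_of_gt hij), if_neg]
        rintro ⟨rfl, h2⟩
        exact absurd hij (not_lt.2 h2.le)
      · intro i; simp [d]
    set h' := h * d with hh'
    have hold : ∀ j : Fin k, j.1 < t → ∀ i, h' i j = if i = u j then 1 else 0 := by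
      intro j hj i
      rw [← hu j hj i, hh', Matrix.mul_apply, Finset.sum_eq_single j]
      · simp [d]
      · intro a _ ha
        have : j ≠ κ := by intro e; rw [e] at hj; simp [κ] at hj
        simp [d, ha, this]
      · simp
    have hinj : ∀ a c : Fin k, a.1 < t → c.1 < t → u a = u c → a = c := by
      intro a c ha hc e
      by_contra hne
      have hdet : IsUnit h := (hb.1.mul hg).mul hb'.1
      have : h.det = 0 := Matrix.det_zero_of_column_eq hne (fun i => by rw [hu a ha, hu c hc, e])
      rw [Matrix.isUnit_iff_isUnit_det, this] at hdet
      exact not_isUnit_zero hdet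
    have hnew : ∀ a : Fin k, a.1 < t → h' (u a) κ = 0 := by
      intro a ha
      have haκ : a < κ := Fin.lt_def.2 ha
      rw [hh', Matrix.mul_apply]
      rw [← Finset.add_sum_erase _ _ (Finset.mem_univ κ),
        ← Finset.add_sum_erase _ _ (Finset.mem_erase.2 ⟨ne_of_lt haκ, Finset.mem_univ a⟩)]
      rw [Finset.sum_eq_zero]
      · simp [d, ne_of_lt haκ, haκ, hu a ha]
      · intro c hc
        simp only [Finset.mem_erase, Finset.mem_univ, and_true] at hc
        by_cases hcκ : c < κ
        · rw [hu c hcκ, if_neg, zero_mul]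
          intro e
          exact hc.1 (hinj a c ha hcκ e).symm
        · simp [d, hc.2, hcκ]
    have hdet : IsUnit h' := ((hb.1.mul hg).mul hb'.1).mul hd.1
    have hnz : (Finset.univ.filter (fun i => h' i κ ≠ 0)).Nonempty := by
      by_contra hne
      rw [Finset.not_nonempty_iff_eq_empty, Finset.filter_eq_empty_iff] at hne
      have : h'.det = 0 := Matrix.det_eq_zero_of_column_eq_zero κ (fun i => by
        simpa using hne (Finset.mem_univ i))
      rw [Matrix.isUnit_iff_isUnit_det, this] at hdet
      exact not_isUnit_zero hdet
    set ι := Finset.max' _ hnz with hι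
    have hι1 : h' ι κ ≠ 0 := by
      have := Finset.max'_mem _ hnz
      rw [← hι] at this
      exact (Finset.mem_filter.1 this).2
    have hι2 : ∀ i, ι < i → h' i κ = 0 := by
      intro i hi
      by_contra hne
      have := Finset.le_max' (Finset.univ.filter (fun i => h' i κ ≠ 0)) i
        (Finset.mem_filter.2 ⟨Finset.mem_univ _, hne⟩)
      exact absurd hi (not_lt.2 this)
    let c : Mat k k := fun i s => if s = ι then (if i = ι then (h' ι κ)⁻¹ else - h' i κ * (h' ι κ)⁻¹)
      else if i = s then 1 else 0
    have hc : c ∈ Bp k := by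
      apply Bp_of_diag
      · intro i s his
        simp only [c]
        by_cases hs : s = ι
        · subst hs
          rw [if_pos rfl, if_neg (ne_of_gt his), hι2 i his]; simp
        · rw [if_neg hs, if_neg (ne_of_gt his)]
      · intro i
        by_cases hs : i = ι
        · simp [c, hs, hι1]
        · simp [c, hs]
    have hcval : ∀ i j, (c * h') i j = (if i = ι then 0 else h' i j) + c i ι * h' ι j := by
      intro i j
      rw [Matrix.mul_apply, ← Finset.add_sum_erase _ _ (Finset.mem_univ ι), add_comm]
      congr 1
      by_cases hi : i = ι
      · rw [if_pos hi]
        apply Finset.sum_eq_zero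
        intro s hs
        have hs := (Finset.mem_erase.1 hs).1
        subst hi
        simp [c, hs, Ne.symm hs]
      · rw [if_neg hi, Finset.sum_eq_single i]
        · simp [c, hi]
        · intro s hs hsi
          have hs := (Finset.mem_erase.1 hs).1
          simp [c, hs, Ne.symm hsi]
        · intro hn
          exact absurd (Finset.mem_erase.2 ⟨hi, Finset.mem_univ i⟩) hn
    refine ⟨c * b, Bp_mul hc hb, b' * d, Bp_mul hb' hd, Function.update u κ ι, ?_⟩
    have e : c * b * g * (b' * d) = c * h' := by
      rw [hh', hh]; simp only [Matrix.mul_assoc]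
    rw [e]
    intro j hj i
    rw [hcval]
    rcases Nat.lt_or_ge j.1 t with hjt | hjt
    · have hjκ : j ≠ κ := by intro e; rw [e] at hjt; simp [κ] at hjt
      rw [Function.update_of_ne hjκ]
      have h0 : h' ι j = 0 := by
        rw [hold j hjt, if_neg]
        intro e
        apply hι1
        rw [e]; exact hnew j hjt
      rw [h0, mul_zero, add_zero]
      split_ifs with h1 h2 h2
      · rw [h1, ] at h2; rw [hold j hjt, h2, if_pos rfl] at h0; exact absurd h0 one_ne_zero
      · rfl
      · rw [hold j hjt, if_pos h2]
      · rw [hold j hjt, if_neg h2]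
    · have hjκ : j = κ := Fin.ext (by simp [κ]; omega)
      subst hjκ
      rw [Function.update_self]
      by_cases hi : i = ι
      · rw [if_pos hi, if_pos hi]; simp [c, hi, hι1]
      · rw [if_neg hi, if_neg hi]; simp [c, hi, hι1]

lemma bruhat_exists {k : ℕ} (g : Mat k k) (hg : IsUnit g) :
    ∃ u : Equiv.Perm (Fin k), g ∈ dcPlus (permMat k u) := by
  obtain ⟨b, hb, b', hb', u, hu⟩ := bruhat_step g hg k le_rfl
  have hinj : Function.Injective u := by
    intro a c e
    by_contra hne
    have hdet : IsUnit (b * g * b') := (hb.1.mul hg).mul hb'.1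
    have : (b * g * b').det = 0 :=
      Matrix.det_zero_of_column_eq hne (fun i => by rw [hu a a.2, hu c c.2, e])
    rw [Matrix.isUnit_iff_isUnit_det, this] at hdet
    exact not_isUnit_zero hdet
  refine ⟨Equiv.ofBijective u (Finite.injective_iff_bijective.1 hinj), ?_⟩
  apply dcPlus_mem_of hb hb'
  refine ⟨1, Bp_one k, 1, Bp_one k, ?_⟩
  rw [Matrix.one_mul, Matrix.mul_one]
  ext i j
  rw [hu j j.2]
  rfl

/-! ### Combinatorics of the Bruhat order -/

def cnt {k : ℕ} (w : Equiv.Perm (Fin k)) (i j : ℕ) : ℕ :=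
  (Finset.univ.filter (fun c : Fin k => c.1 < j ∧ i ≤ (w c).1)).card

lemma cr_perm {k : ℕ} (w : Equiv.Perm (Fin k)) (i j : ℕ) : cr (permMat k w) i j = cnt w i j := by
  unfold cr
  rw [subRank_perm (permMat k w) id w w.injective (fun r c => rfl)]
  unfold cnt
  congr 1
  ext c
  simp

lemma cnt_diff {k : ℕ} {u w : Equiv.Perm (Fin k)} (h : ∀ i j, cnt u i j ≤ cnt w i j)
    (a : Fin k) (ha : u a ≠ w a) (hlt : ∀ c, c < a → u c = w c) : u a < w a := by
  rcases lt_or_gt_of_ne ha with h1 | h1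
  · exact h1
  exfalso
  have := h (u a).1 (a.1 + 1)
  apply absurd this
  rw [not_le]
  apply Finset.card_lt_card
  rw [Finset.ssubset_iff]
  refine ⟨a, by simp [h1], ?_⟩
  intro c hc
  simp only [Finset.mem_insert, Finset.mem_filter, Finset.mem_univ, true_and] at hc ⊢
  rcases hc with rfl | ⟨hc1, hc2⟩
  · exact ⟨by omega, le_rfl⟩
  · refine ⟨hc1, ?_⟩
    rcases lt_or_eq_of_le (show c ≤ a from Fin.le_def.2 (by omega)) with h3 | rfl
    · rw [hlt c h3]; exact hc2
    · exact le_rfl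

lemma exists_first_diff {k : ℕ} {u w : Equiv.Perm (Fin k)} (h : u ≠ w) :
    ∃ a, u a ≠ w a ∧ ∀ c, c < a → u c = w c := by
  have hne : (Finset.univ.filter (fun c => u c ≠ w c)).Nonempty := by
    by_contra hn
    rw [Finset.not_nonempty_iff_eq_empty, Finset.filter_eq_empty_iff] at hn
    exact h (Equiv.ext fun c => by simpa using hn (Finset.mem_univ c))
  refine ⟨Finset.min' _ hne, (Finset.mem_filter.1 (Finset.min'_mem _ hne)).2, ?_⟩
  intro c hc
  by_contra hcn
  exact absurd hc (not_lt.2 (Finset.min'_le _ c (by simp [hcn])))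

lemma cnt_inj {k : ℕ} {u w : Equiv.Perm (Fin k)} (h : ∀ i j, cnt u i j = cnt w i j) : u = w := by
  by_contra hne
  obtain ⟨a, ha, hlt⟩ := exists_first_diff hne
  have h1 := cnt_diff (fun i j => (h i j).le) a ha hlt
  have h2 := cnt_diff (fun i j => (h i j).ge) a ha.symm (fun c hc => (hlt c hc).symm)
  exact absurd h1 (not_lt.2 h2.le)

lemma cnt_swap {k : ℕ} (u : Equiv.Perm (Fin k)) (a b : Fin k) (hab : a < b) (hu : u a < u b)
    (i j : ℕ) : cnt (u * Equiv.swap a b) i j =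
      cnt u i j + if a.1 < j ∧ j ≤ b.1 ∧ (u a).1 < i ∧ i ≤ (u b).1 then 1 else 0 := by
  unfold cnt
  rw [Finset.card_filter, Finset.card_filter]
  have hb : b ∈ Finset.univ.erase a := Finset.mem_erase.2 ⟨ne_of_gt hab, Finset.mem_univ b⟩
  rw [← Finset.add_sum_erase _ _ (Finset.mem_univ a), ← Finset.add_sum_erase _ _ hb,
    ← Finset.add_sum_erase (a := a) _ _ (Finset.mem_univ a), ← Finset.add_sum_erase (a := b) _ _ hb]
  have : ∀ c ∈ (Finset.univ.erase a).erase b,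
      (if c.1 < j ∧ i ≤ ((u * Equiv.swap a b) c).1 then 1 else 0) =
      (if c.1 < j ∧ i ≤ (u c).1 then 1 else 0) := by
    intro c hc
    simp only [Finset.mem_erase, Finset.mem_univ, and_true] at hc
    rw [Equiv.Perm.mul_apply, Equiv.swap_apply_of_ne_of_ne hc.2 hc.1]
  rw [Finset.sum_congr rfl this]
  simp only [Equiv.Perm.mul_apply, Equiv.swap_apply_left, Equiv.swap_apply_right]
  rw [Fin.lt_def] at hab hu
  generalize (∑ x ∈ (Finset.univ.erase a).erase b, if x.1 < j ∧ i ≤ (u x).1 then 1 else 0) = S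
  split_ifs <;> omega

lemma chain_step {k : ℕ} {u w : Equiv.Perm (Fin k)} (h : ∀ i j, cnt u i j ≤ cnt w i j)
    (hne : u ≠ w) : ∃ a b : Fin k, a < b ∧ u a < u b ∧
      ∀ i j, cnt (u * Equiv.swap a b) i j ≤ cnt w i j := by
  obtain ⟨a, ha, hlt⟩ := exists_first_diff hne
  have hlt' := cnt_diff h a ha hlt
  have hex : (Finset.univ.filter (fun b => a < b ∧ u a < u b ∧ u b ≤ w a)).Nonempty := by
    refine ⟨u.symm (w a), ?_⟩
    simp only [Finset.mem_filter, Finset.mem_univ, true_and, Equiv.apply_symm_apply]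
    refine ⟨?_, hlt', le_rfl⟩
    by_contra hc
    rcases lt_or_eq_of_le (not_lt.1 hc) with h1 | h1
    · have := hlt _ h1
      rw [Equiv.apply_symm_apply] at this
      have := w.injective this
      rw [← this] at h1
      exact lt_irrefl _ h1
    · apply ha
      rw [← h1, Equiv.apply_symm_apply, h1]
  set b := Finset.min' _ hex with hb
  have hb1 : a < b ∧ u a < u b ∧ u b ≤ w a := by
    have := Finset.min'_mem _ hex
    rw [← hb] at this
    exact (Finset.mem_filter.1 this).2
  have hb2 : ∀ c, c < b → ¬ (a < c ∧ u a < u c ∧ u c ≤ w a) := by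
    intro c hc hh
    exact absurd hc (not_lt.2 (Finset.min'_le _ c (by simpa using hh)))
  refine ⟨a, b, hb1.1, hb1.2.1, fun i j => ?_⟩
  rw [cnt_swap u a b hb1.1 hb1.2.1]
  split_ifs with hij
  swap
  · exact h i j
  obtain ⟨h1, h2, h3, h4⟩ := hij
  let S : Finset (Fin k) := Finset.univ.filter (fun c => c < a ∧ i ≤ (u c).1 ∧ u c ≤ w a)
  have hw1 := h ((w a).1 + 1) j
  have hA : cnt u i j ≤ cnt u ((w a).1 + 1) j + S.card := by
    unfold cnt
    refine le_trans (Finset.card_le_card ?_) (Finset.card_union_le _ _)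
    intro c hc
    simp only [S, Finset.mem_union, Finset.mem_filter, Finset.mem_univ, true_and] at hc ⊢
    by_cases hcw : u c ≤ w a
    · right
      refine ⟨?_, hc.2, hcw⟩
      by_contra hca
      rcases lt_or_eq_of_le (not_lt.1 hca) with h5 | h5
      · exact hb2 c (Fin.lt_def.2 (by omega)) ⟨h5, Fin.lt_def.2 (by omega), hcw⟩
      · subst h5; omega
    · left
      rw [Fin.le_def] at hcw
      omega
  have hB : cnt w ((w a).1 + 1) j + S.card + 1 ≤ cnt w i j := by
    unfold cnt
    rw [← Finset.card_union_of_disjoint, ← Finset.card_insert_of_notMem (a := a)]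
    · apply Finset.card_le_card
      intro c hc
      simp only [S, Finset.mem_insert, Finset.mem_union, Finset.mem_filter, Finset.mem_univ,
        true_and] at hc ⊢
      have h6 := hb1.2.2
      rw [Fin.le_def] at h6
      rcases hc with rfl | ⟨h5, h7⟩ | ⟨h5, h7, h8⟩
      · omega
      · omega
      · rw [← hlt c h5]
        rw [Fin.lt_def] at h5
        omega
    · simp [S]
    · rw [Finset.disjoint_left]
      intro c hc hc'
      simp only [S, Finset.mem_filter, Finset.mem_univ, true_and] at hc hc'
      rw [← hlt c hc'.1] at hc
      have := hc'.2.2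
      rw [Fin.le_def] at this
      omega
  omega

/-- Induction along the Bruhat order. -/
lemma chain_induction {k : ℕ} (w : Equiv.Perm (Fin k)) (Q : Equiv.Perm (Fin k) → Prop)
    (h0 : Q w) (hs : ∀ (u : Equiv.Perm (Fin k)) (a b : Fin k), a < b → u a < u b →
      Q (u * Equiv.swap a b) → Q u) :
    ∀ u : Equiv.Perm (Fin k), (∀ i j, cnt u i j ≤ cnt w i j) → Q u := by
  have main : ∀ (d : ℕ) (u : Equiv.Perm (Fin k)), (∀ i j, cnt u i j ≤ cnt w i j) →
      (∑ p ∈ Finset.range (k + 1) ×ˢ Finset.range (k + 1), (cnt w p.1 p.2 - cnt u p.1 p.2) = d) →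
      Q u := by
    intro d
    induction d using Nat.strong_induction_on with
    | _ d ih =>
      intro u hu hd
      by_cases hne : u = w
      · rw [hne]; exact h0
      obtain ⟨a, b, hab, huab, hle⟩ := chain_step hu hne
      refine hs u a b hab huab (ih _ ?_ _ hle rfl)
      rw [← hd]
      apply Finset.sum_lt_sum
      · intro p _
        have := cnt_swap u a b hab huab p.1 p.2
        omega
      · refine ⟨((u b).1, b.1), ?_, ?_⟩
        · simp only [Finset.mem_product, Finset.mem_range]
          omega
        · have h1 := cnt_swap u a b hab huab (u b).1 b.1
          have h2 := hle (u b).1 b.1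
          rw [if_pos ⟨hab, le_rfl, huab, le_rfl⟩] at h1
          dsimp only
          omega
  intro u hu
  exact main _ u hu rfl

lemma forall2_countP {α : Type*} [Preorder α] (p : α → Bool)
    (hp : ∀ a b, a ≤ b → p a = true → p b = true)
    {l1 l2 : List α} (h : List.Forall₂ (· ≤ ·) l1 l2) : l1.countP p ≤ l2.countP p := by
  induction h with
  | nil => simp
  | @cons a b l1 l2 hab _ ih =>
    rw [List.countP_cons, List.countP_cons]
    by_cases ha : p a = true
    · simp [ha, hp a b hab ha, ih]
    · simp only [ha]
      simp
      omega

lemma countP_sort {k : ℕ} (A : Finset (Fin k)) (p : Fin k → Bool) :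
    (A.sort (· ≤ ·)).countP p = (A.filter (fun a => p a = true)).card := by
  have e : (A.sort (· ≤ ·)).countP p = (A.sort (· ≤ ·)).countP (fun a => decide (p a = true)) := by
    simp
  rw [e, ← Multiset.coe_countP, Finset.sort_eq, Multiset.countP_eq_card_filter]
  rfl

lemma cnt_le_of_bruhat {k : ℕ} {v w : Equiv.Perm (Fin k)} (h : bruhatLE v w) (i j : ℕ) :
    cnt v i j ≤ cnt w i j := by
  rcases Nat.eq_zero_or_pos (min j k) with hj | hj
  · have : cnt v i j = 0 := by
      unfold cnt
      rw [Finset.card_eq_zero, Finset.filter_eq_empty_iff]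
      intro c _
      have := c.2
      omega
    omega
  have hpk : min j k - 1 < k := by omega
  have h1 := forall2_countP (fun a : Fin k => decide (i ≤ a.1)) (by
    intro a b hab ha
    simp only [decide_eq_true_eq] at ha ⊢
    exact le_trans ha hab) (h ⟨min j k - 1, hpk⟩)
  rw [countP_sort, countP_sort] at h1
  have key : ∀ z : Equiv.Perm (Fin k), (((Finset.Iic (⟨min j k - 1, hpk⟩ : Fin k)).image z).filter
      (fun a => decide (i ≤ a.1) = true)).card = cnt z i j := by
    intro z
    unfold cnt
    rw [Finset.filter_image, Finset.card_image_of_injective _ z.injective]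
    congr 1
    ext c
    simp only [Finset.mem_filter, Finset.mem_Iic, Finset.mem_univ, true_and, decide_eq_true_eq,
      Fin.le_def]
    have := c.2
    constructor
    · rintro ⟨h1, h2⟩; exact ⟨by omega, h2⟩
    · rintro ⟨h1, h2⟩; exact ⟨by omega, h2⟩
  rw [key, key] at h1
  exact h1

/-! ### Corner ranks of the block matrix -/

lemma fe_inl (m n : ℕ) (a : Fin n) : fe m n (Sum.inl a) = castTop a := by
  apply Fin.ext; simp [fe, castTop]

lemma fe_inr (m n : ℕ) (a : Fin m) : fe m n (Sum.inr a) = castBot a := by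
  apply Fin.ext; simp [fe, castBot, Nat.add_comm]

lemma fe_symm_top (m n : ℕ) (a : Fin n) : (fe m n).symm (castTop a) = Sum.inl a := by
  rw [← fe_inl, Equiv.symm_apply_apply]

lemma fe_symm_bot (m n : ℕ) (a : Fin m) : (fe m n).symm (castBot a) = Sum.inr a := by
  rw [← fe_inr, Equiv.symm_apply_apply]

@[simp] lemma castTop_val {m n : ℕ} (a : Fin n) : (castTop a : Fin (m+n)).1 = a.1 := rfl
@[simp] lemma castBot_val {m n : ℕ} (a : Fin m) : (castBot a : Fin (m+n)).1 = n + a.1 := rfl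

lemma castTop_inj {m n : ℕ} : Function.Injective (castTop : Fin n → Fin (m+n)) := by
  intro a b h
  have := congrArg Fin.val h
  simp only [castTop_val] at this
  exact Fin.ext this

lemma castBot_inj {m n : ℕ} : Function.Injective (castBot : Fin m → Fin (m+n)) := by
  intro a b h
  have := congrArg Fin.val h
  simp only [castBot_val] at this
  exact Fin.ext (by omega)

lemma top_or_bot {m n : ℕ} (r : Fin (m+n)) : (∃ a : Fin n, r = castTop a) ∨ (∃ a : Fin m, r = castBot a) := by
  by_cases h : r.1 < n
  · exact Or.inl ⟨⟨r.1, h⟩, Fin.ext rfl⟩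
  · have := r.2
    exact Or.inr ⟨⟨r.1 - n, by omega⟩, Fin.ext (by simp; omega)⟩

lemma rev_iff {k : ℕ} (a b : Fin k) : a = revP k b ↔ a.1 + b.1 + 1 = k := by
  show a = Fin.rev b ↔ _
  rw [Fin.ext_iff, Fin.val_rev]
  have := a.2
  have := b.2
  omega

lemma emb_bot_top {m n : ℕ} (x : Mat m n) (a : Fin m) (b : Fin n) :
    embMat m n x (castBot a) (castTop b) = x a b := by
  simp [embMat, fe_symm_bot, fe_symm_top]

lemma emb_top {m n : ℕ} (x : Mat m n) (r c : Fin (m+n)) (hr : r.1 < n) :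
    embMat m n x r c = if r.1 + c.1 + 1 = n then 1 else 0 := by
  rcases top_or_bot r with ⟨a, rfl⟩ | ⟨a, rfl⟩
  · rcases top_or_bot c with ⟨b, rfl⟩ | ⟨b, rfl⟩
    · have h : a = revP n b ↔
        (castTop a : Fin (m+n)).1 + (castTop b : Fin (m+n)).1 + 1 = n := rev_iff a b
      by_cases h' : a = revP n b
      · rw [if_pos (h.1 h')]
        simp [embMat, fe_symm_top, permMat, h']
      · rw [if_neg (fun e => h' (h.2 e))]
        simp [embMat, fe_symm_top, permMat, h']
    · have h : ¬ ((castTop a : Fin (m+n)).1 + (castBot b : Fin (m+n)).1 + 1 = n) := by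
        simp only [castBot_val]
        omega
      rw [if_neg h]
      simp [embMat, fe_symm_top, fe_symm_bot]
  · simp at hr

lemma emb_bot {m n : ℕ} (x : Mat m n) (r c : Fin (m+n)) (hc : n ≤ c.1) :
    embMat m n x r c = if r.1 + c.1 + 1 = n + n + m then 1 else 0 := by
  rcases top_or_bot c with ⟨b, rfl⟩ | ⟨b, rfl⟩
  · have := b.2
    simp at hc
    omega
  · rcases top_or_bot r with ⟨a, rfl⟩ | ⟨a, rfl⟩
    · have h : ¬ ((castTop a : Fin (m+n)).1 + (castBot b : Fin (m+n)).1 + 1 = n + n + m) := by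
        have := a.2
        have := b.2
        simp only [castTop_val, castBot_val]
        omega
      rw [if_neg h]
      simp [embMat, fe_symm_top, fe_symm_bot]
    · have h0 : ((castBot a : Fin (m+n)).1 + (castBot b : Fin (m+n)).1 + 1 = n + n + m) ↔
          (a.1 + b.1 + 1 = m) := by
        simp only [castBot_val]
        omega
      have h := (rev_iff a b).trans h0.symm
      by_cases h' : a = revP m b
      · rw [if_pos (h.1 h')]
        simp [embMat, fe_symm_bot, permMat, h']
      · rw [if_neg (fun e => h' (h.2 e))]
        simp [embMat, fe_symm_bot, permMat, h']

lemma card_interval (k s t : ℕ) :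
    (Finset.univ.filter (fun a : Fin k => s ≤ a.1 ∧ a.1 < t)).card = min t k - s := by
  rw [← Nat.card_Ico, ← Finset.card_image_of_injective _ Fin.val_injective]
  congr 1
  ext a
  simp only [Finset.mem_image, Finset.mem_filter, Finset.mem_univ, true_and, Finset.mem_Ico]
  constructor
  · rintro ⟨b, hb, rfl⟩
    have := b.2
    omega
  · intro h
    exact ⟨⟨a, by omega⟩, by simp; omega, rfl⟩

/-- rank of the relevant interval submatrix of `x` -/
def rkx {m n : ℕ} (x : Mat m n) (i j : ℕ) : ℕ :=
  subRank x (Finset.univ.filter (fun a => i - n ≤ a.1 ∧ a.1 < m - (j - n)))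
    (Finset.univ.filter (fun b => n - i ≤ b.1 ∧ b.1 < j))

lemma emb_s1 {m n : ℕ} (x : Mat m n) (i j : ℕ) (hi : i ≤ m + n) (hj : j ≤ m + n) :
    cr (embMat m n x) i j + (j - (n - i)) =
    subRank (embMat m n x) (Finset.univ.filter (fun a => max i n ≤ a.1))
      (Finset.univ.filter (fun b => n - i ≤ b.1 ∧ b.1 < j)) + j := by
  have s1 := subRank_pivot (embMat m n x) (Finset.univ.filter (fun a => i ≤ a.1))
    (Finset.univ.filter (fun a => max i n ≤ a.1))
    (Finset.univ.filter (fun b => b.1 < j)) (Finset.univ.filter (fun b => n - i ≤ b.1 ∧ b.1 < j))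
    (by
      intro a ha
      simp only [Finset.mem_filter, Finset.mem_univ, true_and] at ha ⊢
      omega)
    (by
      intro a ha
      simp only [Finset.mem_filter, Finset.mem_univ, true_and] at ha ⊢
      exact ha.2) (by
      intro c hc hc'
      simp only [Finset.mem_filter, Finset.mem_univ, true_and] at hc hc'
      have hlt : n - 1 - c.1 < m + n := by omega
      refine ⟨⟨n - 1 - c.1, hlt⟩, ?_, fun c' _ => ?_⟩
      · simp only [Finset.mem_filter, Finset.mem_univ, true_and]
        omega
      · rw [emb_top x ⟨n - 1 - c.1, hlt⟩ c' (show n - 1 - c.1 < n by omega)]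
        by_cases h : c' = c
        · rw [if_pos h, if_pos]
          rw [h]
          show n - 1 - c.1 + c.1 + 1 = n
          omega
        · rw [if_neg h, if_neg]
          intro e
          apply h
          apply Fin.ext
          have e : n - 1 - c.1 + c'.1 + 1 = n := e
          omega) (by
      intro r hr hr' c hc
      simp only [Finset.mem_filter, Finset.mem_univ, true_and] at hr hr' hc
      have hrn : r.1 < n := by omega
      rw [emb_top x r c hrn, if_neg]
      omega)
  have c1 := card_interval (m + n) (n - i) j
  have c2 : (Finset.univ.filter (fun b : Fin (m+n) => b.1 < j)).card = j := by
    have := card_interval (m + n) 0 j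
    simp only [Nat.zero_le, true_and] at this
    omega
  rw [Nat.min_eq_left hj] at c1
  rw [c1, c2] at s1
  exact s1

lemma emb_s2 {m n : ℕ} (x : Mat m n) (i j : ℕ) (hi : i ≤ m + n) (hj : j ≤ m + n) :
    subRank (embMat m n x) (Finset.univ.filter (fun a => max i n ≤ a.1))
      (Finset.univ.filter (fun b => n - i ≤ b.1 ∧ b.1 < j)) + (n + (m - (j - n)) - max i n) =
    subRank (embMat m n x)
      (Finset.univ.filter (fun a => max i n ≤ a.1 ∧ a.1 < n + (m - (j - n))))
      (Finset.univ.filter (fun b => n - i ≤ b.1 ∧ b.1 < min j n)) + (m + n - max i n) := by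
  have s2 := subRank_pivot (embMat m n x).transpose
    (Finset.univ.filter (fun b => n - i ≤ b.1 ∧ b.1 < j))
    (Finset.univ.filter (fun b => n - i ≤ b.1 ∧ b.1 < min j n))
    (Finset.univ.filter (fun a => max i n ≤ a.1))
    (Finset.univ.filter (fun a => max i n ≤ a.1 ∧ a.1 < n + (m - (j - n))))
    (by
      intro a ha
      simp only [Finset.mem_filter, Finset.mem_univ, true_and] at ha ⊢
      omega)
    (by
      intro a ha
      simp only [Finset.mem_filter, Finset.mem_univ, true_and] at ha ⊢
      exact ha.1) (by
      intro c hc hc'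
      simp only [Finset.mem_filter, Finset.mem_univ, true_and] at hc hc'
      have hc2 := c.2
      have hlt : n + n + m - 1 - c.1 < m + n := by omega
      refine ⟨⟨n + n + m - 1 - c.1, hlt⟩, ?_, fun c' _ => ?_⟩
      · simp only [Finset.mem_filter, Finset.mem_univ, true_and]
        omega
      · rw [Matrix.transpose_apply, emb_bot x c' ⟨n + n + m - 1 - c.1, hlt⟩
          (show n ≤ n + n + m - 1 - c.1 by omega)]
        by_cases h : c' = c
        · rw [if_pos h, if_pos]
          rw [h]
          show c.1 + (n + n + m - 1 - c.1) + 1 = n + n + m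
          omega
        · rw [if_neg h, if_neg]
          intro e
          apply h
          apply Fin.ext
          have e : c'.1 + (n + n + m - 1 - c.1) + 1 = n + n + m := e
          omega) (by
      intro r hr hr' c hc
      simp only [Finset.mem_filter, Finset.mem_univ, true_and] at hr hr' hc
      have hrn : n ≤ r.1 := by omega
      rw [Matrix.transpose_apply, emb_bot x c r hrn, if_neg]
      omega)
  rw [subRank_transpose, subRank_transpose] at s2
  have c3 := card_interval (m + n) (max i n) (n + (m - (j - n)))
  have c4 : (Finset.univ.filter (fun b : Fin (m+n) => max i n ≤ b.1)).card = m + n - max i n := by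
    have := card_interval (m + n) (max i n) (m + n)
    simp only [Fin.is_lt, and_true, min_self] at this
    exact this
  have c5 : min (n + (m - (j - n))) (m + n) = n + (m - (j - n)) := by omega
  rw [c5] at c3
  rw [c3, c4] at s2
  exact s2

lemma emb_s3 {m n : ℕ} (x : Mat m n) (i j : ℕ) :
    subRank (embMat m n x)
      (Finset.univ.filter (fun a => max i n ≤ a.1 ∧ a.1 < n + (m - (j - n))))
      (Finset.univ.filter (fun b => n - i ≤ b.1 ∧ b.1 < min j n)) = rkx x i j := by
  have e : x = (embMat m n x).submatrix castBot castTop := by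
    ext a b
    rw [Matrix.submatrix_apply, emb_bot_top]
  unfold rkx
  conv_rhs => rw [e]
  rw [subRank_image _ _ _ castBot_inj castTop_inj]
  congr 1
  · ext r
    simp only [Finset.mem_image, Finset.mem_filter, Finset.mem_univ, true_and]
    constructor
    · intro h
      exact ⟨⟨r.1 - n, by omega⟩, by simp only; omega, Fin.ext (by simp; omega)⟩
    · rintro ⟨a, ha, rfl⟩
      simp only [castBot_val]
      omega
  · ext r
    simp only [Finset.mem_image, Finset.mem_filter, Finset.mem_univ, true_and]
    constructor
    · intro h
      exact ⟨⟨r.1, by omega⟩, by simp only; omega, Fin.ext (by simp)⟩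
    · rintro ⟨a, ha, rfl⟩
      have := a.2
      simp only [castTop_val]
      omega

lemma cr_emb {m n : ℕ} (x : Mat m n) (i j : ℕ) (hi : i ≤ m + n) (hj : j ≤ m + n) :
    cr (embMat m n x) i j = min (n - i) j + min (m - (i - n)) (j - n) + rkx x i j := by
  have s1 := emb_s1 x i j hi hj
  have s2 := emb_s2 x i j hi hj
  rw [emb_s3] at s2
  generalize subRank (embMat m n x) (Finset.univ.filter (fun a => max i n ≤ a.1))
      (Finset.univ.filter (fun b => n - i ≤ b.1 ∧ b.1 < j)) = A at *
  generalize cr (embMat m n x) i j = B at *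
  generalize rkx x i j = C at *
  rcases le_total i n with h1 | h1 <;> rcases le_total j n with h2 | h2 <;> omega

lemma emb_zero (m n : ℕ) : embMat m n 0 = permMat (m+n) (wnmPerm m n) := by
  ext r c
  rcases top_or_bot r with ⟨a, rfl⟩ | ⟨a, rfl⟩ <;> rcases top_or_bot c with ⟨b, rfl⟩ | ⟨b, rfl⟩
  · have : (castTop a : Fin (m+n)) = castTop ((revP n) b) ↔ a = (revP n) b := castTop_inj.eq_iff
    simp [embMat, permMat, wnmPerm, fe_symm_top, fe_inl, this]
  · have : (castTop a : Fin (m+n)) ≠ castBot ((revP m) b) := by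
      intro h; have := congrArg Fin.val h; have := a.2; simp at *; omega
    simp [embMat, permMat, wnmPerm, fe_symm_top, fe_symm_bot, fe_inr, this]
  · have : (castBot a : Fin (m+n)) ≠ castTop ((revP n) b) := by
      intro h; have := congrArg Fin.val h; have := ((revP n) b).2; simp at *; omega
    simp [embMat, permMat, wnmPerm, fe_symm_top, fe_symm_bot, fe_inl, this]
  · have : (castBot a : Fin (m+n)) = castBot ((revP m) b) ↔ a = (revP m) b := castBot_inj.eq_iff
    simp [embMat, permMat, wnmPerm, fe_symm_bot, fe_inr, this]

lemma rkx_zero (m n i j : ℕ) : rkx (0 : Mat m n) i j = 0 := by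
  unfold rkx subRank
  rw [Matrix.submatrix_zero, ]
  exact Matrix.rank_zero

lemma alpha_le {m n : ℕ} {w : Equiv.Perm (Fin (m+n))} (hw : bruhatLE (wnmPerm m n) w)
    (i j : ℕ) (hi : i ≤ m + n) (hj : j ≤ m + n) :
    min (n - i) j + min (m - (i - n)) (j - n) ≤ cnt w i j := by
  have h1 := cnt_le_of_bruhat hw i j
  rw [← cr_perm, ← emb_zero, cr_emb 0 i j hi hj, rkx_zero] at h1
  omega

lemma emb_isUnit {m n : ℕ} (x : Mat m n) : IsUnit (embMat m n x) := by
  have hr : ∀ k, permMat k (revP k) * permMat k (revP k) = 1 := by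
    intro k
    ext a b
    rw [Matrix.mul_apply, Finset.sum_eq_single (revP k b)]
    · have : (revP k) ((revP k) b) = b := Fin.rev_rev b
      simp [permMat, this, Matrix.one_apply]
    · intro c _ hc
      simp [permMat, hc]
    · simp
  have hu : ∀ k, IsUnit (permMat k (revP k)) := fun k =>
    IsUnit.of_mul_eq_one _ (hr k)
  rw [Matrix.isUnit_iff_isUnit_det]
  unfold embMat
  rw [Matrix.det_reindex_self, Matrix.det_fromBlocks_zero₁₂]
  exact ((Matrix.isUnit_iff_isUnit_det _).1 (hu n)).mul ((Matrix.isUnit_iff_isUnit_det _).1 (hu m))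

/-! ### Zariski closedness of rank conditions -/

lemma exists_indep_cols {R C : Type*} [Fintype R] [Fintype C] (A : Matrix R C ℂ) :
    ∃ g : Fin A.rank → C, LinearIndependent ℂ (fun i => A.col (g i)) := by
  have h := Submodule.exists_fun_fin_finrank_span_eq ℂ (Set.range A.col)
  rw [← Matrix.rank_eq_finrank_span_cols] at h
  obtain ⟨f, hf, -, hli⟩ := h
  choose g hg using hf
  refine ⟨g, ?_⟩
  have : (fun i => A.col (g i)) = f := funext hg
  rw [this]
  exact hli

lemma exists_minor {R C : Type*} [Fintype R] [Fintype C] (A : Matrix R C ℂ) :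
    ∃ (f : Fin A.rank → R) (g : Fin A.rank → C), (A.submatrix f g).det ≠ 0 := by
  obtain ⟨g, hg⟩ := exists_indep_cols A
  set A' := (A.submatrix id g).transpose with hA'
  have h1 : A'.rank = A.rank := by
    have : LinearIndependent ℂ A'.row := hg
    have := this.rank_matrix
    rw [Fintype.card_fin] at this
    exact this
  obtain ⟨f, hf⟩ := exists_indep_cols A'
  refine ⟨fun i => f (Fin.cast h1.symm i), g, ?_⟩
  have h2 : LinearIndependent ℂ
      (A.submatrix (fun i => f (Fin.cast h1.symm i)) g).row :=
    hf.comp (Fin.cast h1.symm) (Fin.cast_injective _)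
  rw [Matrix.linearIndependent_rows_iff_isUnit, Matrix.isUnit_iff_isUnit_det] at h2
  exact h2.ne_zero

lemma zClosure_rank {k l : ℕ} {S : Set (Mat k l)} {x : Mat k l} (hx : x ∈ zClosure S)
    (R : Finset (Fin k)) (C : Finset (Fin l)) (r : ℕ) (h : ∀ y ∈ S, subRank y R C ≤ r) :
    subRank x R C ≤ r := by
  by_contra hlt
  rw [not_le] at hlt
  unfold subRank at hlt
  obtain ⟨f, g, hd⟩ := exists_minor
    (x.submatrix (fun i : {a // a ∈ R} => i.1) (fun j : {a // a ∈ C} => j.1))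
  let P : MvPolynomial (Fin k × Fin l) ℂ :=
    (Matrix.of (fun i j => MvPolynomial.X ((f i).1, (g j).1))).det
  have hP : ∀ y : Mat k l, MvPolynomial.eval (fun q => y q.1 q.2) P =
      ((y.submatrix (fun i : {a // a ∈ R} => i.1) (fun j : {a // a ∈ C} => j.1)).submatrix f g).det := by
    intro y
    simp only [P]
    rw [RingHom.map_det]
    congr 1
    ext i j
    simp
  have := hx P (by
    intro y hy
    rw [hP]
    by_contra hne
    have h1 := Matrix.rank_of_det_ne_zero hne
    rw [Fintype.card_fin] at h1
    have h2 := Matrix.rank_submatrix_le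
      (y.submatrix (fun i : {a // a ∈ R} => i.1) (fun j : {a // a ∈ C} => j.1)) f g
    have h3 := h y hy
    unfold subRank at h3
    omega)
  rw [hP] at this
  exact hd this

/-! ### Euclidean closure is contained in the Zariski closure -/

lemma closure_sub_zClosure {k l : ℕ} {S : Set (Mat k l)} {x : Mat k l} (hx : x ∈ closure S) :
    x ∈ zClosure S := by
  intro p hp
  have hc : Continuous (fun y : Mat k l => MvPolynomial.eval (fun q => y q.1 q.2) p) := by
    have h1 := MvPolynomial.continuous_eval (X := ℂ) p
    refine h1.comp ?_
    refine continuous_pi fun q => ?_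
    exact Continuous.matrix_elem continuous_id _ _
  have hcl : IsClosed {y : Mat k l | MvPolynomial.eval (fun q => y q.1 q.2) p = 0} :=
    isClosed_eq hc continuous_const
  exact closure_minimal (fun y hy => hp y hy) hcl hx

/-! ### The cell move -/

lemma mul_permMat {k : ℕ} (A : Mat k k) (u : Equiv.Perm (Fin k)) (i j : Fin k) :
    (A * permMat k u) i j = A i (u j) := by
  simp [Matrix.mul_apply, permMat]

lemma cell_move {k : ℕ} (u : Equiv.Perm (Fin k)) (a b : Fin k) (hab : a < b) (hu : u a < u b)
    (s : ℂ) (hs : s ≠ 0) :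
    (1 + Matrix.single (u b) (u a) s) * permMat k u ∈
      dcPlus (permMat k (u * Equiv.swap a b)) := by
  refine ⟨1 + Matrix.single (u a) (u b) s⁻¹, ?_,
    Matrix.diagonal (fun c => if c = a then s else if c = b then -s⁻¹ else 1) +
      Matrix.single a b 1, ?_, ?_⟩
  · apply Bp_of_diag
    · intro i j hij
      have h1 : i ≠ j := hij.ne'
      have h2 : ¬ (u a = i ∧ u b = j) := by
        rintro ⟨rfl, rfl⟩
        exact absurd hij (not_lt.2 hu.le)
      simp [Matrix.one_apply_ne h1, Matrix.single_apply, h2]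
    · intro i
      have h2 : ¬ (u a = i ∧ u b = i) := by
        rintro ⟨h, h'⟩
        rw [h, h'] at hu
        exact lt_irrefl _ hu
      simp [Matrix.single_apply, h2]
  · apply Bp_of_diag
    · intro i j hij
      have h1 : i ≠ j := hij.ne'
      have h2 : ¬ (a = i ∧ b = j) := by
        rintro ⟨rfl, rfl⟩
        exact absurd hij (not_lt.2 hab.le)
      simp [Matrix.diagonal_apply_ne _ h1, Matrix.single_apply, h2]
    · intro i
      have h2 : ¬ (a = i ∧ b = i) := by
        rintro ⟨rfl, rfl⟩
        exact lt_irrefl _ hab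
      simp only [Matrix.add_apply, Matrix.diagonal_apply_eq, Matrix.single_apply, h2, if_false,
        add_zero]
      split_ifs <;> simp [hs]
  · ext i j
    rw [mul_permMat, Matrix.mul_add, Matrix.add_apply, Matrix.add_apply, Matrix.mul_diagonal, mul_permMat]
    have hab' : a ≠ b := hab.ne
    have hu' : u a ≠ u b := hu.ne
    by_cases hjb : j = b
    · subst hjb
      rw [Matrix.mul_single_apply_same, mul_permMat]
      simp [Matrix.single_apply, Matrix.one_apply, hab'.symm, hab', hu', hu'.symm]
      by_cases h1 : i = u a
      · subst h1; simp [hu', hs]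
      · by_cases h2 : i = u j
        · subst h2; simp [hu', hs, hu'.symm]
        · simp [h1, h2, Ne.symm h1, Ne.symm h2]
    · rw [Matrix.mul_single_apply_of_ne (hbj := hjb), add_zero]
      by_cases hja : j = a
      · subst hja
        simp [Matrix.single_apply, Matrix.one_apply, hu', hu'.symm]
        by_cases h1 : i = u j
        · subst h1; simp [hu', hs, hu'.symm]
        · by_cases h2 : i = u b
          · subst h2; simp [hu', hs, hu'.symm]
          · simp [h1, h2, Ne.symm h1, Ne.symm h2]
      · have e1 : u a ≠ u j := fun h => hja (u.injective h).symm
        have e2 : u b ≠ u j := fun h => hjb (u.injective h).symm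
        simp [Matrix.single_apply, hja, hjb, Equiv.swap_apply_of_ne_of_ne hja hjb, e1, e2]

/-! ### Local slice lemma -/

lemma permMat_rev_mul {k l : ℕ} (A : Mat k l) (i : Fin k) (j : Fin l) :
    (permMat k (revP k) * A) i j = A (revP k i) j := by
  rw [Matrix.mul_apply, Finset.sum_eq_single (revP k i)]
  · have : i = revP k (revP k i) := (Fin.rev_rev i).symm
    simp only [permMat]
    rw [if_pos this, one_mul]
  · intro b _ hb
    have : i ≠ revP k b := by
      rintro rfl
      exact hb (Fin.rev_rev b).symm
    simp [permMat, this]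
  · simp

lemma mul_permMat' {l k : ℕ} (A : Mat l k) (u : Equiv.Perm (Fin k)) (i : Fin l) (j : Fin k) :
    (A * permMat k u) i j = A i (u j) := by
  simp [Matrix.mul_apply, permMat]

lemma rev_solve {k : ℕ} (A : Mat k k) : ∃ c b : Mat k k,
    (∀ i j, j < i → c i j = 0) ∧ (∀ i j, j < i → b i j = 0) ∧
    c * permMat k (revP k) + permMat k (revP k) * b = A := by
  refine ⟨Matrix.of fun i j => if i ≤ j then A i (revP k j) else 0,
    Matrix.of fun i j => if i < j then A (revP k i) j else 0, ?_, ?_, ?_⟩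
  · intro i j h
    simp [not_le.2 h]
  · intro i j h
    simp [not_lt.2 h.le]
  · ext i j
    rw [Matrix.add_apply, mul_permMat', permMat_rev_mul]
    have e : ∀ a, revP k (revP k a) = a := fun a => Fin.rev_rev a
    simp only [Matrix.of_apply, e]
    have hv : ∀ a, (revP k a).1 + a.1 + 1 = k := fun a => by
      have := a.2
      simp only [revP, Equiv.coe_fn_mk, Fin.val_rev]; omega
    have h1 := hv i
    have h2 := hv j
    by_cases h : i ≤ revP k j
    · have h' : ¬ revP k i < j := by
        rw [Fin.le_def] at h; rw [Fin.lt_def]; omega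
      rw [if_pos h, if_neg h', add_zero]
    · have h' : revP k i < j := by
        rw [Fin.le_def] at h; rw [Fin.lt_def]; omega
      rw [if_neg h, if_pos h', zero_add]

def upT {k : ℕ} (C : Mat k k) : Mat k k := fun i j => if i ≤ j then C i j else 0

def lowX (m n : ℕ) (X : Mat m n) : Mat (m+n) (m+n) :=
  Matrix.reindex (fe m n) (fe m n) (Matrix.fromBlocks 0 0 X 0)

lemma emb_add {m n : ℕ} (x X : Mat m n) : embMat m n (x + X) = embMat m n x + lowX m n X := by
  ext i j
  simp only [embMat, lowX, Matrix.reindex_apply, Matrix.submatrix_apply, Matrix.add_apply]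
  rcases (fe m n).symm i with a | a <;> rcases (fe m n).symm j with b | b <;> simp

lemma upT_blocks {m n : ℕ} (c1 : Mat n n) (c12 : Mat n m) (c2 : Mat m m)
    (h1 : ∀ i j, j < i → c1 i j = 0) (h2 : ∀ i j, j < i → c2 i j = 0) :
    upT (Matrix.reindex (fe m n) (fe m n) (Matrix.fromBlocks c1 c12 0 c2)) =
      Matrix.reindex (fe m n) (fe m n) (Matrix.fromBlocks c1 c12 0 c2) := by
  ext i j
  simp only [upT]
  split_ifs with h
  · rfl
  · rw [not_le] at h
    symm
    rcases top_or_bot i with ⟨a, rfl⟩ | ⟨a, rfl⟩ <;> rcases top_or_bot j with ⟨b, rfl⟩ | ⟨b, rfl⟩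
    · simp only [Matrix.reindex_apply, Matrix.submatrix_apply, fe_symm_top, Matrix.fromBlocks_apply₁₁]
      exact h1 _ _ h
    · have := a.2
      rw [Fin.lt_def] at h
      simp at h
      omega
    · simp [fe_symm_top, fe_symm_bot]
    · simp only [Matrix.reindex_apply, Matrix.submatrix_apply, fe_symm_bot, Matrix.fromBlocks_apply₂₂]
      apply h2
      rw [Fin.lt_def] at h ⊢
      simp at h
      omega

lemma lin_solve {m n : ℕ} (x : Mat m n) (A : Mat (m+n) (m+n)) :
    ∃ (C : Mat (m+n) (m+n)) (X : Mat m n) (B : Mat (m+n) (m+n)),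
      upT C * embMat m n x + lowX m n X + embMat m n x * upT B = A := by
  set A' := (Matrix.reindex (fe m n) (fe m n)).symm A with hA'
  have hA : A = Matrix.reindex (fe m n) (fe m n) (Matrix.fromBlocks A'.toBlocks₁₁ A'.toBlocks₁₂
      A'.toBlocks₂₁ A'.toBlocks₂₂) := by
    rw [Matrix.fromBlocks_toBlocks, hA', Equiv.apply_symm_apply]
  obtain ⟨c1, b1, hc1, hb1, e1⟩ := rev_solve A'.toBlocks₁₁
  obtain ⟨c2, b2, hc2, hb2, e2⟩ :=
    rev_solve (A'.toBlocks₂₂ - x * (permMat n (revP n) * A'.toBlocks₁₂))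
  have hww : permMat n (revP n) * (permMat n (revP n) * A'.toBlocks₁₂) = A'.toBlocks₁₂ := by
    ext i j
    rw [permMat_rev_mul, permMat_rev_mul]
    congr 1
    exact Fin.rev_rev i
  refine ⟨Matrix.reindex (fe m n) (fe m n) (Matrix.fromBlocks c1 0 0 c2),
    A'.toBlocks₂₁ - c2 * x - x * b1,
    Matrix.reindex (fe m n) (fe m n)
      (Matrix.fromBlocks b1 (permMat n (revP n) * A'.toBlocks₁₂) 0 b2), ?_⟩
  rw [upT_blocks _ _ _ hc1 hc2, upT_blocks _ _ _ hb1 hb2]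
  conv_rhs => rw [hA]
  simp only [embMat, lowX, Matrix.reindex_apply, Matrix.submatrix_mul_equiv,
    Matrix.fromBlocks_multiply]
  have hs : ∀ P Q : Matrix (Fin n ⊕ Fin m) (Fin n ⊕ Fin m) ℂ,
      P.submatrix (fe m n).symm (fe m n).symm + Q.submatrix (fe m n).symm (fe m n).symm =
      (P + Q).submatrix (fe m n).symm (fe m n).symm := fun _ _ => rfl
  simp only [hs, Matrix.fromBlocks_add]
  congr 2
  · simpa using e1
  · simpa using hww
  · simp only [add_zero, zero_add, Matrix.zero_mul, Matrix.mul_zero]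
    try abel
  · have : c2 * permMat m (revP m) + (x * (permMat n (revP n) * A'.toBlocks₁₂) +
        permMat m (revP m) * b2) = A'.toBlocks₂₂ := by
      rw [add_left_comm, e2]; abel
    simpa using this

section slice
open Filter Topology

lemma line_expand {R : Type*} [Ring R] [Algebra ℂ R] (t : ℂ) (a E L b : R) :
    (1 + t • a) * (E + t • L) * (1 + t • b) = E + t • (a * E + L + E * b) +
      t^2 • (a * L + a * E * b + L * b) + t^3 • (a * L * b) := by
  simp only [add_mul, mul_add, one_mul, mul_one, smul_mul_assoc, mul_smul_comm, smul_add, smul_smul]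
  rw [show t * (t * t) = t^3 by ring, show t * t = t^2 by ring]
  abel

lemma map_nhds_of_lines {E F : Type*} [NormedAddCommGroup E] [NormedSpace ℂ E] [CompleteSpace E]
    [NormedAddCommGroup F] [NormedSpace ℂ F] [CompleteSpace F] {f : E → F} (hf : ContDiff ℂ 1 f)
    (h : ∀ A : F, ∃ (v : E) (P Q : F), ∀ t : ℂ, f (t • v) = f 0 + t • A + t^2 • P + t^3 • Q) :
    map f (𝓝 0) = 𝓝 (f 0) := by
  have h0 := (hf.contDiffAt (x := 0)).hasStrictFDerivAt (by simp)
  refine h0.map_nhds_eq_of_surj ?_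
  rw [LinearMap.range_eq_top]
  intro A
  obtain ⟨v, P, Q, hv⟩ := h A
  refine ⟨v, ?_⟩
  have h1 : HasDerivAt (fun t : ℂ => f (t • v)) (fderiv ℂ f 0 v) 0 := by
    have hl : HasDerivAt (fun t : ℂ => t • v) ((1 : ℂ) • v) 0 :=
      (hasDerivAt_id (0:ℂ)).smul_const _
    rw [one_smul] at hl
    refine HasFDerivAt.comp_hasDerivAt (0:ℂ) ?_ hl
    rw [zero_smul]
    exact h0.hasFDerivAt
  have h2 : HasDerivAt (fun t : ℂ => f (t • v)) A 0 := by
    simp only [hv]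
    have e1 := (hasDerivAt_id (0:ℂ)).smul_const A
    have e2 := ((hasDerivAt_id (0:ℂ)).pow 2).smul_const P
    have e3 := ((hasDerivAt_id (0:ℂ)).pow 3).smul_const Q
    have := ((e1.const_add (f 0)).add e2).add e3
    simp at this
    exact this
  exact h1.unique h2

attribute [local instance] Matrix.normedAddCommGroup Matrix.normedSpace

def sliceF (m n : ℕ) (x : Mat m n) (v : Mat (m+n) (m+n) × Mat m n × Mat (m+n) (m+n)) :
    Mat (m+n) (m+n) :=
  (1 + upT v.1) * embMat m n (x + v.2.1) * (1 + upT v.2.2)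

lemma contDiff_matrix {E : Type*} [NormedAddCommGroup E] [NormedSpace ℂ E] {k l : ℕ}
    {f : E → Mat k l} (h : ∀ i j, ContDiff ℂ 1 (fun v => f v i j)) : ContDiff ℂ 1 f :=
  contDiff_pi.2 fun i => contDiff_pi.2 fun j => h i j

lemma contDiff_entry {E : Type*} [NormedAddCommGroup E] [NormedSpace ℂ E] {k l : ℕ}
    {f : E → Mat k l} (h : ContDiff ℂ 1 f) (i j) : ContDiff ℂ 1 (fun v => f v i j) :=
  contDiff_pi.1 (contDiff_pi.1 h i) j

lemma contDiff_mmul {E : Type*} [NormedAddCommGroup E] [NormedSpace ℂ E] {k l p : ℕ}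
    {f : E → Mat k l} {g : E → Mat l p} (hf : ContDiff ℂ 1 f) (hg : ContDiff ℂ 1 g) :
    ContDiff ℂ 1 (fun v => f v * g v) := by
  apply contDiff_matrix
  intro i j
  simp only [Matrix.mul_apply]
  exact ContDiff.sum fun c _ => (contDiff_entry hf i c).mul (contDiff_entry hg c j)

lemma contDiff_upT {E : Type*} [NormedAddCommGroup E] [NormedSpace ℂ E] {k : ℕ}
    {f : E → Mat k k} (hf : ContDiff ℂ 1 f) : ContDiff ℂ 1 (fun v => upT (f v)) := by
  apply contDiff_matrix
  intro i j
  simp only [upT]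
  split_ifs
  · exact contDiff_entry hf i j
  · exact contDiff_const

lemma contDiff_lowX {E : Type*} [NormedAddCommGroup E] [NormedSpace ℂ E] {m n : ℕ}
    {f : E → Mat m n} (hf : ContDiff ℂ 1 f) : ContDiff ℂ 1 (fun v => lowX m n (f v)) := by
  apply contDiff_matrix
  intro i j
  simp only [lowX, Matrix.reindex_apply, Matrix.submatrix_apply]
  rcases (fe m n).symm i with a | a <;> rcases (fe m n).symm j with b | b
  · simpa using contDiff_const
  · simpa using contDiff_const
  · simpa using contDiff_entry hf a b
  · simpa using contDiff_const

lemma contDiff_sliceF {m n : ℕ} (x : Mat m n) : ContDiff ℂ 1 (sliceF m n x) := by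
  unfold sliceF
  simp only [emb_add]
  refine contDiff_mmul (contDiff_mmul ?_ ?_) ?_
  · exact contDiff_const.add (contDiff_upT contDiff_fst)
  · exact contDiff_const.add (contDiff_lowX (contDiff_fst.comp contDiff_snd))
  · exact contDiff_const.add (contDiff_upT (contDiff_snd.comp contDiff_snd))

lemma upT_smul {k : ℕ} (t : ℂ) (C : Mat k k) : upT (t • C) = t • upT C := by
  ext i j
  simp [upT]

lemma lowX_smul {m n : ℕ} (t : ℂ) (C : Mat m n) : lowX m n (t • C) = t • lowX m n C := by
  ext i j
  simp only [lowX, Matrix.reindex_apply, Matrix.submatrix_apply, Matrix.smul_apply]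
  rcases (fe m n).symm i with a | a <;> rcases (fe m n).symm j with b | b <;> simp

lemma sliceF_zero {m n : ℕ} (x : Mat m n) : sliceF m n x 0 = embMat m n x := by
  have h : upT (0 : Mat (m+n) (m+n)) = 0 := by ext i j; simp [upT]
  simp [sliceF, h]

lemma sliceF_line {m n : ℕ} (x : Mat m n) (C X B) (t : ℂ) :
    sliceF m n x (t • (C, X, B)) = embMat m n x +
      t • (upT C * embMat m n x + lowX m n X + embMat m n x * upT B) +
      t^2 • (upT C * lowX m n X + upT C * embMat m n x * upT B + lowX m n X * upT B) +
      t^3 • (upT C * lowX m n X * upT B) := by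
  simp only [sliceF, Prod.smul_mk, emb_add, upT_smul, lowX_smul]
  exact line_expand t _ _ _ _

lemma slice_nhds {m n : ℕ} (x : Mat m n) :
    map (sliceF m n x) (𝓝 0) = 𝓝 (embMat m n x) := by
  rw [← sliceF_zero x]
  refine map_nhds_of_lines (contDiff_sliceF x) ?_
  intro A
  obtain ⟨C, X, B, h⟩ := lin_solve x A
  refine ⟨(C, X, B), (upT C * lowX m n X + upT C * embMat m n x * upT B + lowX m n X * upT B),
    (upT C * lowX m n X * upT B), fun t => ?_⟩
  rw [sliceF_zero, ← h]
  exact sliceF_line x C X B t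

end slice

/-! ### Closure relations -/
section closure_rel
open Filter Topology

lemma slice_nhds' {m n : ℕ} (x : Mat m n) :
    map (sliceF m n x) (𝓝 0) = 𝓝 (embMat m n x) := slice_nhds x

lemma one_add_upT_mem {k : ℕ} (C : Mat k k) (h : ∀ i, 1 + C i i ≠ 0) : 1 + upT C ∈ Bp k := by
  apply Bp_of_diag
  · intro i j hij
    simp [upT, Matrix.one_apply_ne hij.ne', not_le.2 hij]
  · intro i
    simpa [upT] using h i

lemma ev_diag {k : ℕ} : ∀ᶠ C : Mat k k in 𝓝 0, ∀ i, 1 + C i i ≠ 0 := by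
  rw [eventually_all]
  intro i
  have hc : Continuous (fun C : Mat k k => 1 + C i i) :=
    continuous_const.add (Continuous.matrix_elem continuous_id i i)
  have := hc.tendsto 0
  exact this.eventually_ne (by simp)

lemma slice_lemma {m n : ℕ} (x : Mat m n) (U : Set (Mat m n)) (hU : U ∈ 𝓝 x) :
    ∀ᶠ g in 𝓝 (embMat m n x), ∃ c ∈ Bp (m+n), ∃ x' ∈ U, ∃ b ∈ Bp (m+n),
      g = c * embMat m n x' * b := by
  rw [← slice_nhds', eventually_map]
  have t1 : Tendsto (fun v : Mat (m+n) (m+n) × Mat m n × Mat (m+n) (m+n) => v.1) (𝓝 0) (𝓝 0) :=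
    continuous_fst.tendsto 0
  have t2 : Tendsto (fun v : Mat (m+n) (m+n) × Mat m n × Mat (m+n) (m+n) => x + v.2.1) (𝓝 0)
      (𝓝 x) := by
    have : Continuous (fun v : Mat (m+n) (m+n) × Mat m n × Mat (m+n) (m+n) => x + v.2.1) :=
      continuous_const.add (continuous_fst.comp continuous_snd)
    have := this.tendsto 0
    simpa using this
  have t3 : Tendsto (fun v : Mat (m+n) (m+n) × Mat m n × Mat (m+n) (m+n) => v.2.2) (𝓝 0) (𝓝 0) :=
    (continuous_snd.comp continuous_snd).tendsto 0
  filter_upwards [t1.eventually ev_diag, t2 hU, t3.eventually ev_diag] with v h1 h2 h3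
  exact ⟨_, one_add_upT_mem _ h1, _, h2, _, one_add_upT_mem _ h3, rfl⟩

lemma Pset_closure_step {m n : ℕ} (u : Equiv.Perm (Fin (m+n))) (a b : Fin (m+n)) (hab : a < b)
    (hu : u a < u b) : Pset m n u ⊆ closure (Pset m n (u * Equiv.swap a b)) := by
  rintro x ⟨b0, hb0, b1, hb1, hx⟩
  rw [mem_closure_iff_nhds]
  intro U hU
  have hs := slice_lemma x U hU
  have hc : Continuous (fun s : ℂ => b0 * ((1 + Matrix.single (u b) (u a) s) *
      permMat (m+n) u) * b1) := by
    have : Continuous (fun s : ℂ => Matrix.single (u b) (u a) s) := by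
      refine continuous_matrix fun i j => ?_
      simp only [Matrix.single_apply]
      split_ifs
      · exact continuous_id
      · exact continuous_const
    fun_prop
  have ht := hc.tendsto 0
  have e0 : b0 * ((1 + Matrix.single (u b) (u a) (0:ℂ)) * permMat (m+n) u) * b1 = embMat m n x := by
    rw [hx]; simp
  rw [e0] at ht
  have h1 := (ht.eventually hs).filter_mono (nhdsWithin_le_nhds (s := {(0:ℂ)}ᶜ))
  have h2 := h1.and (eventually_mem_nhdsWithin (a := (0:ℂ)) (s := {(0:ℂ)}ᶜ))
  obtain ⟨s, ⟨c, hc, x', hx', d, hd, he⟩, hs0⟩ := h2.exists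
  refine ⟨x', hx', ?_⟩
  obtain ⟨p, hp, q, hq, hpq⟩ := cell_move u a b hab hu s hs0
  refine dcPlus_mem_of hc hd ?_
  rw [← he, hpq]
  refine ⟨b0 * p, Bp_mul hb0 hp, q * b1, Bp_mul hq hb1, ?_⟩
  simp only [Matrix.mul_assoc]

lemma Pset_sub_closure {m n : ℕ} (w u : Equiv.Perm (Fin (m+n)))
    (h : ∀ i j, cnt u i j ≤ cnt w i j) : Pset m n u ⊆ closure (Pset m n w) := by
  refine chain_induction w (fun u => Pset m n u ⊆ closure (Pset m n w)) subset_closure ?_ u h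
  intro u a b hab hu hQ
  exact (Pset_closure_step u a b hab hu).trans (closure_minimal hQ isClosed_closure)

end closure_rel

/-! ### Conversion of rank conditions -/

lemma subRank_le_height {k l : ℕ} (x : Mat k l) (R : Finset (Fin k)) (C : Finset (Fin l)) :
    subRank x R C ≤ R.card := by
  unfold subRank
  have := Matrix.rank_le_card_height
    (x.submatrix (fun i : {a // a ∈ R} => i.1) (fun j : {a // a ∈ C} => j.1))
  simpa using this

lemma subRank_le_width {k l : ℕ} (x : Mat k l) (R : Finset (Fin k)) (C : Finset (Fin l)) :
    subRank x R C ≤ C.card := by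
  unfold subRank
  have := Matrix.rank_le_card_width
    (x.submatrix (fun i : {a // a ∈ R} => i.1) (fun j : {a // a ∈ C} => j.1))
  simpa using this

lemma subE {k : ℕ} (w : Equiv.Perm (Fin k)) (R C : Finset (Fin k)) :
    subRank (permMat k w) R C = (C.filter (fun c => w c ∈ R)).card := by
  rw [subRank_perm (permMat k w) id w w.injective (fun r c => rfl) R C]
  congr 1
  ext c
  simp

def c00 {k : ℕ} (w : Equiv.Perm (Fin k)) (i j : ℕ) : ℕ :=
  (Finset.univ.filter (fun c : Fin k => c.1 < j ∧ (w c).1 < i)).card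
def c01 {k : ℕ} (w : Equiv.Perm (Fin k)) (i j : ℕ) : ℕ :=
  (Finset.univ.filter (fun c : Fin k => j ≤ c.1 ∧ (w c).1 < i)).card
def c11 {k : ℕ} (w : Equiv.Perm (Fin k)) (i j : ℕ) : ℕ :=
  (Finset.univ.filter (fun c : Fin k => j ≤ c.1 ∧ i ≤ (w c).1)).card

lemma card_split {α : Type*} [Fintype α] (P Q S T : α → Prop) [DecidablePred P] [DecidablePred Q]
    [DecidablePred S] [DecidablePred T] (hT : ∀ a, S a ↔ P a ∧ T a) (hQ : ∀ a, Q a ↔ P a ∧ ¬ T a) :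
    (Finset.univ.filter S).card + (Finset.univ.filter Q).card = (Finset.univ.filter P).card := by
  rw [← Finset.card_filter_add_card_filter_not (s := Finset.univ.filter P) T,
    Finset.filter_filter, Finset.filter_filter]
  congr 2
  · ext a; simp [hT]
  · ext a; simp [hQ]

lemma card_lt (k t : ℕ) (h : t ≤ k) :
    (Finset.univ.filter (fun a : Fin k => a.1 < t)).card = t := by
  have := card_interval k 0 t
  simp only [Nat.zero_le, true_and] at this
  rw [this]; omega

lemma card_ge (k s : ℕ) :
    (Finset.univ.filter (fun a : Fin k => s ≤ a.1)).card = k - s := by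
  have := card_interval k s k
  simp only [Fin.is_lt, and_true] at this
  rw [this]; omega

lemma card_perm_lt {k : ℕ} (w : Equiv.Perm (Fin k)) (t : ℕ) (h : t ≤ k) :
    (Finset.univ.filter (fun a : Fin k => (w a).1 < t)).card = t := by
  refine Eq.trans ?_ (card_lt k t h)
  refine Finset.card_bij (fun a _ => w a) ?_ ?_ ?_
  · intro a ha; simpa using ha
  · intro a _ b _ hab; exact w.injective hab
  · intro b hb; exact ⟨w.symm b, by simpa using hb, by simp⟩

lemma cnt_c00 {k : ℕ} (w : Equiv.Perm (Fin k)) (i j : ℕ) (hj : j ≤ k) : cnt w i j + c00 w i j = j := by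
  unfold cnt c00
  conv_rhs => rw [← card_lt k j hj]
  exact card_split _ _ _ (fun c => i ≤ (w c).1) (fun a => Iff.rfl) (fun a => by rw [not_le])

lemma c00_c01 {k : ℕ} (w : Equiv.Perm (Fin k)) (i j : ℕ) (hi : i ≤ k) : c00 w i j + c01 w i j = i := by
  unfold c00 c01
  conv_rhs => rw [← card_perm_lt w i hi]
  exact card_split _ _ _ (fun c => c.1 < j) (fun a => and_comm) (fun a => by rw [not_lt]; exact and_comm)

lemma c01_c11 {k : ℕ} (w : Equiv.Perm (Fin k)) (i j : ℕ) : c01 w i j + c11 w i j = k - j := by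
  unfold c01 c11
  conv_rhs => rw [← card_ge k j]
  exact card_split _ _ _ (fun c => (w c).1 < i) (fun a => Iff.rfl) (fun a => by rw [not_lt])

lemma revP_val {k : ℕ} (a : Fin k) : (revP k a).1 + a.1 + 1 = k := by
  have := a.2
  simp only [revP, Equiv.coe_fn_mk, Fin.val_rev]; omega

lemma im1 {m n : ℕ} (p : Fin m) : (Finset.Ici p).image (castBot : Fin m → Fin (m+n)) =
    Finset.univ.filter (fun a => n + p.1 ≤ a.1) := by
  ext a
  simp only [Finset.mem_image, Finset.mem_Ici, Finset.mem_filter, Finset.mem_univ, true_and]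
  constructor
  · rintro ⟨b, hb, rfl⟩
    simpa using hb
  · intro h
    have := a.2
    exact ⟨⟨a.1 - n, by omega⟩, by rw [Fin.le_def]; simp only; omega,
      Fin.ext (by simp only [castBot_val]; omega)⟩

lemma im2 {m n : ℕ} (q : Fin n) : (Finset.Iic q).image (castTop : Fin n → Fin (m+n)) =
    Finset.univ.filter (fun a => a.1 < q.1 + 1) := by
  ext a
  simp only [Finset.mem_image, Finset.mem_Iic, Finset.mem_filter, Finset.mem_univ, true_and]
  constructor
  · rintro ⟨b, hb, rfl⟩
    rw [Fin.le_def] at hb; simp only [castTop_val]; omega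
  · intro h
    have := q.2
    exact ⟨⟨a.1, by omega⟩, by rw [Fin.le_def]; simp only; omega,
      Fin.ext (by simp only [castTop_val])⟩

lemma im3 {m n : ℕ} (q : Fin n) :
    (Finset.Ici q).image (fun c => (castTop (revP n c) : Fin (m+n))) =
    Finset.univ.filter (fun a => a.1 < n - q.1) := by
  ext a
  simp only [Finset.mem_image, Finset.mem_Ici, Finset.mem_filter, Finset.mem_univ, true_and]
  constructor
  · rintro ⟨b, hb, rfl⟩
    have := revP_val b
    rw [Fin.le_def] at hb; simp only [castTop_val]; omega
  · intro h
    have := q.2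
    refine ⟨⟨n - 1 - a.1, by omega⟩, by rw [Fin.le_def]; simp only; omega, ?_⟩
    have := revP_val (⟨n - 1 - a.1, by omega⟩ : Fin n)
    exact Fin.ext (by simp only [castTop_val]; simp only at this; omega)

lemma im4 {m n : ℕ} (p : Fin m) :
    (Finset.Iic p).image (fun c => (castBot (revP m c) : Fin (m+n))) =
    Finset.univ.filter (fun a => n + m - 1 - p.1 ≤ a.1) := by
  ext a
  simp only [Finset.mem_image, Finset.mem_Iic, Finset.mem_filter, Finset.mem_univ, true_and]
  constructor
  · rintro ⟨b, hb, rfl⟩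
    have := revP_val b
    rw [Fin.le_def] at hb; simp only [castBot_val]; omega
  · intro h
    have := p.2
    have := a.2
    refine ⟨⟨n + m - 1 - a.1, by omega⟩, by rw [Fin.le_def]; simp only; omega, ?_⟩
    have := revP_val (⟨n + m - 1 - a.1, by omega⟩ : Fin m)
    exact Fin.ext (by simp only [castBot_val]; simp only at this; omega)

lemma im5 {m n : ℕ} (p q : Fin n) : (Finset.Icc p q).image (castTop : Fin n → Fin (m+n)) =
    Finset.univ.filter (fun a => p.1 ≤ a.1 ∧ a.1 < q.1 + 1) := by
  ext a
  simp only [Finset.mem_image, Finset.mem_Icc, Finset.mem_filter, Finset.mem_univ, true_and]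
  constructor
  · rintro ⟨b, hb, rfl⟩
    rw [Fin.le_def, Fin.le_def] at hb; simp only [castTop_val]; omega
  · intro h
    have := q.2
    exact ⟨⟨a.1, by omega⟩, by rw [Fin.le_def, Fin.le_def]; simp only; omega,
      Fin.ext (by simp only [castTop_val])⟩

lemma im6 {m n : ℕ} (p q : Fin m) : (Finset.Icc p q).image (castBot : Fin m → Fin (m+n)) =
    Finset.univ.filter (fun a => n + p.1 ≤ a.1 ∧ a.1 < n + q.1 + 1) := by
  ext a
  simp only [Finset.mem_image, Finset.mem_Icc, Finset.mem_filter, Finset.mem_univ, true_and]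
  constructor
  · rintro ⟨b, hb, rfl⟩
    rw [Fin.le_def, Fin.le_def] at hb; simp only [castBot_val]; omega
  · intro h
    have := q.2
    exact ⟨⟨a.1 - n, by omega⟩, by rw [Fin.le_def, Fin.le_def]; simp only; omega,
      Fin.ext (by simp only [castBot_val]; omega)⟩

def alp (m n i j : ℕ) : ℕ := min (n - i) j + min (m - (i - n)) (j - n)

lemma castBot_rev_inj {m n : ℕ} :
    Function.Injective (fun c => (castBot (revP m c) : Fin (m+n))) :=
  castBot_inj.comp (revP m).injective

lemma castTop_rev_inj {m n : ℕ} :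
    Function.Injective (fun c => (castTop (revP n c) : Fin (m+n))) :=
  castTop_inj.comp (revP n).injective

lemma rkx_eq {m n : ℕ} (x : Mat m n) (i j : ℕ) (R : Finset (Fin m)) (C : Finset (Fin n))
    (hR : ∀ a : Fin m, a ∈ R ↔ i - n ≤ a.1 ∧ a.1 < m - (j - n))
    (hC : ∀ b : Fin n, b ∈ C ↔ n - i ≤ b.1 ∧ b.1 < j) : subRank x R C = rkx x i j := by
  unfold rkx
  congr 1
  · ext a; simp [hR]
  · ext a; simp [hC]

lemma xA {m n : ℕ} (x : Mat m n) (p : Fin m) (q : Fin n) :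
    subRank x (Finset.Ici p) (Finset.Iic q) = rkx x (n + p.1) (q.1 + 1) := by
  have := q.2
  apply rkx_eq
  · intro a; have := a.2; rw [Finset.mem_Ici, Fin.le_def]; omega
  · intro a; have := a.2; rw [Finset.mem_Iic, Fin.le_def]; omega

lemma xB {m n : ℕ} (x : Mat m n) (p : Fin m) (q : Fin n) :
    subRank x (Finset.Iic p) (Finset.Ici q) = rkx x (n - q.1) (n + m - 1 - p.1) := by
  have := q.2
  have := p.2
  apply rkx_eq
  · intro a; have := a.2; rw [Finset.mem_Iic, Fin.le_def]; omega
  · intro a; have := a.2; rw [Finset.mem_Ici, Fin.le_def]; omega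

lemma xC {m n : ℕ} (x : Mat m n) (p q : Fin n) :
    subRank x Finset.univ (Finset.Icc p q) = rkx x (n - p.1) (q.1 + 1) := by
  have := q.2
  have := p.2
  apply rkx_eq
  · intro a; have := a.2; simp only [Finset.mem_univ, true_iff]; omega
  · intro a; have := a.2; rw [Finset.mem_Icc, Fin.le_def, Fin.le_def]; omega

lemma xD {m n : ℕ} (x : Mat m n) (p q : Fin m) :
    subRank x (Finset.Icc p q) Finset.univ = rkx x (n + p.1) (n + m - 1 - q.1) := by
  have := q.2
  have := p.2
  apply rkx_eq
  · intro a; have := a.2; rw [Finset.mem_Icc, Fin.le_def, Fin.le_def]; omega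
  · intro a; have := a.2; simp only [Finset.mem_univ, true_iff]; omega

lemma wA {m n : ℕ} (w : Equiv.Perm (Fin (m+n))) (p : Fin m) (q : Fin n) :
    subRank (blk21 m n (permMat (m+n) w)) (Finset.Ici p) (Finset.Iic q) =
      cnt w (n + p.1) (q.1 + 1) := by
  unfold blk21
  rw [subRank_image _ _ _ castBot_inj castTop_inj, im1, im2, subE, Finset.filter_filter]
  unfold cnt
  congr 1
  ext c
  simp

lemma wB {m n : ℕ} (w : Equiv.Perm (Fin (m+n))) (p : Fin m) (q : Fin n) :
    subRank (permMat m (revP m) * (blk12 m n (permMat (m+n) w)).transpose * permMat n (revP n))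
      (Finset.Iic p) (Finset.Ici q) = c01 w (n - q.1) (n + m - 1 - p.1) := by
  have e : permMat m (revP m) * (blk12 m n (permMat (m+n) w)).transpose * permMat n (revP n) =
      ((permMat (m+n) w).submatrix (fun c => castTop (revP n c))
        (fun c => castBot (revP m c))).transpose := by
    ext i j
    rw [mul_permMat', permMat_rev_mul]
    rfl
  rw [e, subRank_transpose, subRank_image _ _ _ castTop_rev_inj castBot_rev_inj, im3, im4, subE,
    Finset.filter_filter]
  unfold c01
  congr 1
  ext c
  simp

lemma wC {m n : ℕ} (w : Equiv.Perm (Fin (m+n))) (p q : Fin n) (hpq : p ≤ q) :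
    subRank (permMat n (revP n) * blk11 m n (permMat (m+n) w)) (Finset.Ici p) (Finset.Icc p q)
      + c00 w (n - p.1) p.1 = c00 w (n - p.1) (q.1 + 1) := by
  have e : permMat n (revP n) * blk11 m n (permMat (m+n) w) =
      (permMat (m+n) w).submatrix (fun c => castTop (revP n c)) castTop := by
    ext i j
    rw [permMat_rev_mul]
    rfl
  rw [e, subRank_image _ _ _ castTop_rev_inj castTop_inj, im3, im5, subE, Finset.filter_filter]
  unfold c00
  rw [Fin.le_def] at hpq
  refine card_split _ _ _ (fun c => p.1 ≤ c.1) ?_ ?_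
  · intro a
    simp only [Finset.mem_filter, Finset.mem_univ, true_and]
    omega
  · intro a
    omega

lemma wD {m n : ℕ} (w : Equiv.Perm (Fin (m+n))) (p q : Fin m) (hpq : p ≤ q) :
    subRank (blk22 m n (permMat (m+n) w) * permMat m (revP m)) (Finset.Icc p q) (Finset.Iic q)
      + c11 w (n + q.1 + 1) (n + m - 1 - q.1) = c11 w (n + p.1) (n + m - 1 - q.1) := by
  have e : blk22 m n (permMat (m+n) w) * permMat m (revP m) =
      (permMat (m+n) w).submatrix castBot (fun c => castBot (revP m c)) := by
    ext i j
    rw [mul_permMat']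
    rfl
  rw [e, subRank_image _ _ _ castBot_inj castBot_rev_inj, im6, im4, subE, Finset.filter_filter]
  unfold c11
  rw [Fin.le_def] at hpq
  refine card_split _ _ _ (fun c => (w c).1 < n + q.1 + 1) ?_ ?_
  · intro a
    simp only [Finset.mem_filter, Finset.mem_univ, true_and]
    omega
  · intro a
    omega

lemma fB {m n : ℕ} (w : Equiv.Perm (Fin (m+n))) (p : Fin m) (q : Fin n) :
    subRank (permMat m (revP m) * (blk12 m n (permMat (m+n) w)).transpose * permMat n (revP n))
      (Finset.Iic p) (Finset.Ici q) + alp m n (n - q.1) (n + m - 1 - p.1)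
      = cnt w (n - q.1) (n + m - 1 - p.1) := by
  have hp := p.2
  have hq := q.2
  rw [wB]
  have h1 := cnt_c00 w (n - q.1) (n + m - 1 - p.1) (by omega)
  have h2 := c00_c01 w (n - q.1) (n + m - 1 - p.1) (by omega)
  unfold alp
  omega

lemma fC {m n : ℕ} {w : Equiv.Perm (Fin (m+n))} (hw : bruhatLE (wnmPerm m n) w)
    (p q : Fin n) (hpq : p ≤ q) :
    (q.1 : ℤ) + 1 - (p.1 : ℤ) -
      (subRank (permMat n (revP n) * blk11 m n (permMat (m+n) w)) (Finset.Ici p)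
        (Finset.Icc p q) : ℤ) =
      (cnt w (n - p.1) (q.1 + 1) : ℤ) - (alp m n (n - p.1) (q.1 + 1) : ℤ) := by
  have hp := p.2
  have hq := q.2
  have h0 := wC w p q hpq
  have h1 := cnt_c00 w (n - p.1) (q.1 + 1) (by omega)
  have h2 := cnt_c00 w (n - p.1) p.1 (by omega)
  have h3 := alpha_le hw (n - p.1) p.1 (by omega) (by omega)
  rw [Fin.le_def] at hpq
  unfold alp
  omega

lemma fD {m n : ℕ} {w : Equiv.Perm (Fin (m+n))} (hw : bruhatLE (wnmPerm m n) w)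
    (p q : Fin m) (hpq : p ≤ q) :
    (q.1 : ℤ) + 1 - (p.1 : ℤ) -
      (subRank (blk22 m n (permMat (m+n) w) * permMat m (revP m)) (Finset.Icc p q)
        (Finset.Iic q) : ℤ) =
      (cnt w (n + p.1) (n + m - 1 - q.1) : ℤ) - (alp m n (n + p.1) (n + m - 1 - q.1) : ℤ) := by
  have hp := p.2
  have hq := q.2
  have h0 := wD w p q hpq
  have h1 := cnt_c00 w (n + p.1) (n + m - 1 - q.1) (by omega)
  have h2 := c00_c01 w (n + p.1) (n + m - 1 - q.1) (by omega)
  have h3 := c01_c11 w (n + p.1) (n + m - 1 - q.1)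
  have h4 := cnt_c00 w (n + q.1 + 1) (n + m - 1 - q.1) (by omega)
  have h5 := c00_c01 w (n + q.1 + 1) (n + m - 1 - q.1) (by omega)
  have h6 := c01_c11 w (n + q.1 + 1) (n + m - 1 - q.1)
  have h7 := alpha_le hw (n + q.1 + 1) (n + m - 1 - q.1) (by omega) (by omega)
  rw [Fin.le_def] at hpq
  unfold alp
  omega

lemma grid {m n : ℕ} (Q : ℕ → ℕ → Prop)
    (ha : ∀ (p : Fin m) (q : Fin n), Q (n + p.1) (q.1 + 1))
    (hb : ∀ (p : Fin m) (q : Fin n), Q (n - q.1) (n + m - 1 - p.1))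
    (hc : ∀ p q : Fin n, 1 ≤ p.1 → p ≤ q → Q (n - p.1) (q.1 + 1))
    (hd : ∀ p q : Fin m, p ≤ q → q.1 + 2 ≤ m → Q (n + p.1) (n + m - 1 - q.1))
    (ht : ∀ i j, i ≤ m + n → j ≤ m + n → (i = 0 ∨ j = 0 ∨ i = m + n ∨ j = m + n ∨ j ≤ n - i ∨
      (n ≤ i ∧ n ≤ j ∧ m - (j - n) ≤ i - n)) → Q i j) :
    ∀ i j, i ≤ m + n → j ≤ m + n → Q i j := by
  intro i j hi hj
  by_cases h : (i = 0 ∨ j = 0 ∨ i = m + n ∨ j = m + n ∨ j ≤ n - i ∨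
      (n ≤ i ∧ n ≤ j ∧ m - (j - n) ≤ i - n))
  · exact ht i j hi hj h
  · push Not at h
    obtain ⟨h1, h2, h3, h4, h5, h6⟩ := h
    by_cases hin : n ≤ i
    · by_cases hjn : j ≤ n
      · have := ha ⟨i - n, by omega⟩ ⟨j - 1, by omega⟩
        simp only at this
        convert this using 1 <;> omega
      · have h6' := h6 hin (by omega)
        have := hd ⟨i - n, by omega⟩ ⟨m - 1 - (j - n), by omega⟩
          (by rw [Fin.le_def]; simp only; omega) (by simp only; omega)
        simp only at this
        convert this using 1 <;> omega
    · by_cases hjn : n ≤ j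
      · have := hb ⟨m - 1 - (j - n), by omega⟩ ⟨n - i, by omega⟩
        simp only at this
        convert this using 1 <;> omega
      · have := hc ⟨n - i, by omega⟩ ⟨j - 1, by omega⟩ (by simp only; omega)
          (by rw [Fin.le_def]; simp only; omega)
        simp only at this
        convert this using 1 <;> omega

lemma trivial_cases {m n : ℕ} {w : Equiv.Perm (Fin (m+n))} (hw : bruhatLE (wnmPerm m n) w)
    (x : Mat m n) (i j : ℕ) (hi : i ≤ m + n) (hj : j ≤ m + n)
    (h : i = 0 ∨ j = 0 ∨ i = m + n ∨ j = m + n ∨ j ≤ n - i ∨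
      (n ≤ i ∧ n ≤ j ∧ m - (j - n) ≤ i - n)) :
    alp m n i j + rkx x i j = cnt w i j := by
  have h1 := cnt_c00 w i j hj
  have h2 := c00_c01 w i j hi
  have h3 := c01_c11 w i j
  have h4 := alpha_le hw i j hi hj
  have h5 : rkx x i j ≤ min m (m - (j - n)) - (i - n) := by
    have := subRank_le_height x (Finset.univ.filter (fun a => i - n ≤ a.1 ∧ a.1 < m - (j - n)))
      (Finset.univ.filter (fun b => n - i ≤ b.1 ∧ b.1 < j))
    rw [card_interval, min_comm] at this
    exact this
  have h6 : rkx x i j ≤ min j n - (n - i) := by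
    have := subRank_le_width x (Finset.univ.filter (fun a => i - n ≤ a.1 ∧ a.1 < m - (j - n)))
      (Finset.univ.filter (fun b => n - i ≤ b.1 ∧ b.1 < j))
    rw [card_interval] at this
    exact this
  unfold alp
  omega

lemma cnt_cap {k : ℕ} (w : Equiv.Perm (Fin k)) (i j : ℕ) :
    cnt w i j = cnt w (min i k) (min j k) := by
  unfold cnt
  congr 1
  ext c
  have := c.2
  have := (w c).2
  simp only [Finset.mem_filter, Finset.mem_univ, true_and]
  omega

lemma Pset_rk {m n : ℕ} {x : Mat m n} {w : Equiv.Perm (Fin (m+n))} (h : x ∈ Pset m n w)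
    (i j : ℕ) (hi : i ≤ m + n) (hj : j ≤ m + n) : alp m n i j + rkx x i j = cnt w i j := by
  have h1 := cr_of_mem h i j
  rw [cr_perm, cr_emb x i j hi hj] at h1
  exact h1

lemma exists_Pset {m n : ℕ} (x : Mat m n) : ∃ u, x ∈ Pset m n u :=
  bruhat_exists (embMat m n x) (emb_isUnit x)

lemma mem_Pset_iff {m n : ℕ} (x : Mat m n) (w : Equiv.Perm (Fin (m+n))) :
    x ∈ Pset m n w ↔ ∀ i j, i ≤ m + n → j ≤ m + n → alp m n i j + rkx x i j = cnt w i j := by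
  refine ⟨fun h i j hi hj => Pset_rk h i j hi hj, fun h => ?_⟩
  obtain ⟨u, hu⟩ := exists_Pset x
  have : u = w := by
    apply cnt_inj
    intro i j
    rw [cnt_cap u, cnt_cap w, ← h _ _ (min_le_right _ _) (min_le_right _ _),
      Pset_rk hu _ _ (min_le_right _ _) (min_le_right _ _)]
  rwa [← this]

lemma mem_zClosure_iff {m n : ℕ} (x : Mat m n) (w : Equiv.Perm (Fin (m+n)))
    (hw : bruhatLE (wnmPerm m n) w) :
    x ∈ zClosure (Pset m n w) ↔
      ∀ i j, i ≤ m + n → j ≤ m + n → alp m n i j + rkx x i j ≤ cnt w i j := by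
  constructor
  · intro h i j hi hj
    have h1 : rkx x i j ≤ cnt w i j - alp m n i j := by
      refine zClosure_rank h _ _ _ ?_
      intro y hy
      have := Pset_rk hy i j hi hj
      change rkx y i j ≤ _
      omega
    have h2 : alp m n i j ≤ cnt w i j := alpha_le hw i j hi hj
    omega
  · intro h
    obtain ⟨u, hu⟩ := exists_Pset x
    apply closure_sub_zClosure
    refine Pset_sub_closure w u ?_ hu
    intro i j
    rw [cnt_cap u, cnt_cap w, ← Pset_rk hu _ _ (min_le_right _ _) (min_le_right _ _)]
    exact h _ _ (min_le_right _ _) (min_le_right _ _)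


theorem statement7 (m n : ℕ) (hm : 0 < m) (hn : 0 < n)
    (x : Mat m n) (w : Equiv.Perm (Fin (m+n))) (hw : bruhatLE (wnmPerm m n) w)
    (w11 : Mat n n) (h11 : w11 = blk11 m n (permMat (m+n) w))
    (w12 : Mat n m) (h12 : w12 = blk12 m n (permMat (m+n) w))
    (w21 : Mat m n) (h21 : w21 = blk21 m n (permMat (m+n) w))
    (w22 : Mat m m) (h22 : w22 = blk22 m n (permMat (m+n) w)) :
    (x ∈ Pset m n w ↔
      -- (a)
      ((∀ (p : Fin m) (q : Fin n),
        subRank x (Finset.Ici p) (Finset.Iic q) = subRank w21 (Finset.Ici p) (Finset.Iic q)) ∧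
      -- (b)
      (∀ (p : Fin m) (q : Fin n),
        subRank x (Finset.Iic p) (Finset.Ici q) =
          subRank (permMat m (revP m) * w12.transpose * permMat n (revP n))
            (Finset.Iic p) (Finset.Ici q)) ∧
      -- (c)
      (∀ p q : Fin n, 1 ≤ (p:ℕ) → p ≤ q →
        (subRank x Finset.univ (Finset.Icc p q) : ℤ) =
          (q:ℤ) + 1 - (p:ℤ) -
            (subRank (permMat n (revP n) * w11) (Finset.Ici p) (Finset.Icc p q) : ℤ)) ∧
      -- (d)
      (∀ p q : Fin m, p ≤ q → (q:ℕ) + 2 ≤ m →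
        (subRank x (Finset.Icc p q) Finset.univ : ℤ) =
          (q:ℤ) + 1 - (p:ℤ) -
            (subRank (w22 * permMat m (revP m)) (Finset.Icc p q) (Finset.Iic q) : ℤ)))) ∧
    (x ∈ zClosure (Pset m n w) ↔
      ((∀ (p : Fin m) (q : Fin n),
        subRank x (Finset.Ici p) (Finset.Iic q) ≤ subRank w21 (Finset.Ici p) (Finset.Iic q)) ∧
      (∀ (p : Fin m) (q : Fin n),
        subRank x (Finset.Iic p) (Finset.Ici q) ≤
          subRank (permMat m (revP m) * w12.transpose * permMat n (revP n))
            (Finset.Iic p) (Finset.Ici q)) ∧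
      (∀ p q : Fin n, 1 ≤ (p:ℕ) → p ≤ q →
        (subRank x Finset.univ (Finset.Icc p q) : ℤ) ≤
          (q:ℤ) + 1 - (p:ℤ) -
            (subRank (permMat n (revP n) * w11) (Finset.Ici p) (Finset.Icc p q) : ℤ)) ∧
      (∀ p q : Fin m, p ≤ q → (q:ℕ) + 2 ≤ m →
        (subRank x (Finset.Icc p q) Finset.univ : ℤ) ≤
          (q:ℤ) + 1 - (p:ℤ) -
            (subRank (w22 * permMat m (revP m)) (Finset.Icc p q) (Finset.Iic q) : ℤ)))) := by
  subst h11 h12 h21 h22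
  have zA : ∀ (p : Fin m) (q : Fin n), alp m n (n + p.1) (q.1 + 1) = 0 := by
    intro p q
    have := q.2
    unfold alp
    omega
  constructor
  · rw [mem_Pset_iff]
    constructor
    · intro h
      refine ⟨?_, ?_, ?_, ?_⟩
      · intro p q
        have hp := p.2
        have hq := q.2
        have := h (n + p.1) (q.1 + 1) (by omega) (by omega)
        rw [xA, wA]
        have := zA p q
        omega
      · intro p q
        have hp := p.2
        have hq := q.2
        have := h (n - q.1) (n + m - 1 - p.1) (by omega) (by omega)
        rw [xB]
        have := fB w p q
        omega
      · intro p q _ hpq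
        have hp := p.2
        have hq := q.2
        have := h (n - p.1) (q.1 + 1) (by omega) (by omega)
        rw [xC, fC hw p q hpq]
        omega
      · intro p q hpq _
        have hp := p.2
        have hq := q.2
        have := h (n + p.1) (n + m - 1 - q.1) (by omega) (by omega)
        rw [xD, fD hw p q hpq]
        omega
    · rintro ⟨ha, hb, hc, hd⟩
      apply grid
      · intro p q
        have := ha p q
        rw [xA, wA] at this
        have := zA p q
        omega
      · intro p q
        have := hb p q
        rw [xB] at this
        have := fB w p q
        omega
      · intro p q h1 hpq
        have := hc p q h1 hpq
        rw [xC, fC hw p q hpq] at this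
        omega
      · intro p q hpq h1
        have := hd p q hpq h1
        rw [xD, fD hw p q hpq] at this
        omega
      · exact trivial_cases hw x
  · rw [mem_zClosure_iff x w hw]
    constructor
    · intro h
      refine ⟨?_, ?_, ?_, ?_⟩
      · intro p q
        have hp := p.2
        have hq := q.2
        have := h (n + p.1) (q.1 + 1) (by omega) (by omega)
        rw [xA, wA]
        have := zA p q
        omega
      · intro p q
        have hp := p.2
        have hq := q.2
        have := h (n - q.1) (n + m - 1 - p.1) (by omega) (by omega)
        rw [xB]
        have := fB w p q
        omega
      · intro p q _ hpq
        have hp := p.2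
        have hq := q.2
        have := h (n - p.1) (q.1 + 1) (by omega) (by omega)
        rw [xC, fC hw p q hpq]
        omega
      · intro p q hpq _
        have hp := p.2
        have hq := q.2
        have := h (n + p.1) (n + m - 1 - q.1) (by omega) (by omega)
        rw [xD, fD hw p q hpq]
        omega
    · rintro ⟨ha, hb, hc, hd⟩
      apply grid
      · intro p q
        have := ha p q
        rw [xA, wA] at this
        have := zA p q
        omega
      · intro p q
        have := hb p q
        rw [xB] at this
        have := fB w p q
        omega
      · intro p q h1 hpq
        have := hc p q h1 hpq
        rw [xC, fC hw p q hpq] at this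
        omega
      · intro p q hpq h1
        have := hd p q hpq h1
        rw [xD, fD hw p q hpq] at this
        omega
      · exact fun i j hi hj h => (trivial_cases hw x i j hi hj h).le
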